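/- arXiv:1502.06774 — 8 statements merged into one kernel-verified Lean document; each statement's English description precedes it below -/
import Mathlib

section
/- The function Φ_*(y) = y·arsinh(y) + 1 − √(1 + y²) satisfies the Δ₂-condition in the following quantitative form: for every α ∈ ℝ and every y ∈ ℝ, Φ_*(α·y) ≤ max(1, α²)·Φ_*(y). -/
/-- The conjugate Young function `Φ_*(y) = y·arsinh y + 1 − √(1 + y²)`. -/
noncomputable def PhiStar (y : ℝ) : ℝ := y * Real.arsinh y + 1 - Real.sqrt (1 + y ^ 2)

theorem PhiStar_zero : PhiStar 0 = 0 := by simp [PhiStar]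

theorem PhiStar_neg (y : ℝ) : PhiStar (-y) = PhiStar y := by
  simp [PhiStar, Real.arsinh_neg]

theorem PhiStar_abs (y : ℝ) : PhiStar |y| = PhiStar y := by
  rcases abs_choice y with h | h <;> rw [h]
  exact PhiStar_neg y

theorem hasDerivAt_PhiStar (y : ℝ) : HasDerivAt PhiStar (Real.arsinh y) y := by
  have hpos : 0 < 1 + y ^ 2 := by positivity
  have hsq : HasDerivAt (fun x : ℝ => 1 + x ^ 2) (2 * y) y := by
    simpa using (hasDerivAt_pow 2 y).const_add 1
  have h := (((hasDerivAt_id y).mul (Real.hasDerivAt_arsinh y)).add_const 1).sub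
    (hsq.sqrt hpos.ne')
  refine h.congr_deriv ?_
  have := (Real.sqrt_pos.2 hpos).ne'
  simp only [id]
  field_simp
  ring

theorem monotoneOn_Ici_of_hasDerivAt_nonneg {f f' : ℝ → ℝ} (hf : ∀ x, HasDerivAt f (f' x) x)
    (hf' : ∀ x, 0 ≤ x → 0 ≤ f' x) : MonotoneOn f (Set.Ici 0) := by
  refine monotoneOn_of_hasDerivWithinAt_nonneg (convex_Ici 0)
    (fun x _ => (hf x).continuousAt.continuousWithinAt)
    (fun x _ => (hf x).hasDerivWithinAt) fun x hx => hf' x ?_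
  rw [interior_Ici] at hx
  exact le_of_lt hx

theorem PhiStar_monotoneOn : MonotoneOn PhiStar (Set.Ici 0) :=
  monotoneOn_Ici_of_hasDerivAt_nonneg hasDerivAt_PhiStar
    fun _ hx => Real.arsinh_nonneg_iff.2 hx

theorem arsinh_mul_le {a y : ℝ} (ha : 1 ≤ a) (hy : 0 ≤ y) :
    Real.arsinh (a * y) ≤ a * Real.arsinh y := by
  have hm : MonotoneOn (fun x => a * Real.arsinh x - Real.arsinh (a * x)) (Set.Ici 0) := by
    refine monotoneOn_Ici_of_hasDerivAt_nonneg
      (fun x => ((Real.hasDerivAt_arsinh x).const_mul a).sub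
        ((hasDerivAt_const_mul a).arsinh)) fun x hx => ?_
    have hle : x ^ 2 ≤ (a * x) ^ 2 := by gcongr; nlinarith
    have hinv : (√(1 + (a * x) ^ 2))⁻¹ ≤ (√(1 + x ^ 2))⁻¹ := by gcongr
    simp only [smul_eq_mul]
    nlinarith
  have h := hm (Set.self_mem_Ici) (Set.mem_Ici.2 hy) hy
  simp only [Real.arsinh_zero, mul_zero, sub_zero] at h
  linarith

theorem PhiStar_mul_le {a y : ℝ} (ha : 1 ≤ a) (hy : 0 ≤ y) :
    PhiStar (a * y) ≤ a ^ 2 * PhiStar y := by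
  have hm : MonotoneOn (fun x => a ^ 2 * PhiStar x - PhiStar (a * x)) (Set.Ici 0) := by
    refine monotoneOn_Ici_of_hasDerivAt_nonneg
      (fun x => ((hasDerivAt_PhiStar x).const_mul (a ^ 2)).sub
        ((hasDerivAt_PhiStar (a * x)).comp x (hasDerivAt_const_mul a))) fun x hx => ?_
    nlinarith [arsinh_mul_le ha hx]
  have h := hm (Set.self_mem_Ici) (Set.mem_Ici.2 hy) hy
  simp only [PhiStar_zero, mul_zero, sub_zero] at h
  linarith

/-- `Φ_*` satisfies the Δ₂-condition in the quantitative form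
`Φ_*(α·y) ≤ max(1, α²)·Φ_*(y)` for all real `α`, `y`. -/
theorem phiStar_delta_two (α y : ℝ) :
    PhiStar (α * y) ≤ max 1 (α ^ 2) * PhiStar y := by
  rw [← PhiStar_abs (α * y), ← PhiStar_abs y, abs_mul, ← sq_abs α]
  have hy := abs_nonneg y
  have hα := abs_nonneg α
  have hnonneg : 0 ≤ PhiStar |y| := by
    simpa only [PhiStar_zero] using PhiStar_monotoneOn Set.self_mem_Ici (Set.mem_Ici.2 hy) hy
  rcases le_total |α| 1 with h | h
  · calc PhiStar (|α| * |y|) ≤ PhiStar |y| :=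
          PhiStar_monotoneOn (Set.mem_Ici.2 (by positivity)) (Set.mem_Ici.2 hy)
            (mul_le_of_le_one_left hy h)
      _ ≤ max 1 (|α| ^ 2) * PhiStar |y| :=
          le_mul_of_one_le_left hnonneg (le_max_left _ _)
  · exact (PhiStar_mul_le h hy).trans
      (mul_le_mul_of_nonneg_right (le_max_right _ _) hnonneg)
end

section
/- Let (Ω, F, μ) be a σ-finite measure space, p a density, k ≥ 1, and u₁, …, u_k ∈ L^Φ(p). Then the product u₁·u₂⋯u_k belongs to L^r(p) for every 1 < r < ∞, i.e. ∫ |u₁⋯u_k|^r p dμ < ∞ for all 1 < r < ∞. -/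
open MeasureTheory ENNReal

/-- The Young function `Φ(x) = cosh x − 1`. -/
noncomputable def Phi (x : ℝ) : ℝ := Real.cosh x - 1

/-- The measure `p·μ` associated to a density `p`. -/
noncomputable def densMeasure {Ω : Type*} [MeasurableSpace Ω] (μ : Measure Ω) (p : Ω → ℝ) :
    Measure Ω := μ.withDensity fun x => ENNReal.ofReal (p x)

open ProbabilityTheory

lemma exp_le_two_mul_Phi_add_two (x : ℝ) : Real.exp x ≤ 2 * Phi x + 2 := by
  rw [Phi, Real.cosh_eq]
  linarith [Real.exp_pos (-x)]

lemma Phi_nonneg (x : ℝ) : 0 ≤ Phi x := sub_nonneg.2 (Real.one_le_cosh x)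

lemma Phi_neg (x : ℝ) : Phi (-x) = Phi x := by rw [Phi, Real.cosh_neg, Phi]

lemma measurable_Phi : Measurable Phi := by
  unfold Phi
  exact Real.measurable_cosh.sub_const 1

/-- A function with `Φ(αU)` integrable for some `α > 0` has all moments. -/
lemma memLp_of_lintegral_Phi_lt_top {Ω : Type*} [MeasurableSpace Ω] {ν : Measure Ω}
    [IsFiniteMeasure ν] {U : Ω → ℝ} (hU : Measurable U) {α : ℝ} (hα : 0 < α)
    (h : ∫⁻ x, ENNReal.ofReal (Phi (α * U x)) ∂ν < ⊤) (q : NNReal) : MemLp U q ν := by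
  have hPhi : Integrable (fun x => Phi (α * U x)) ν :=
    ⟨(measurable_Phi.comp (hU.const_mul α)).aestronglyMeasurable,
      (hasFiniteIntegral_iff_ofReal (ae_of_all _ fun _ => Phi_nonneg _)).2 h⟩
  have hexp : ∀ s : ℝ, (∀ x, Phi (s * x) = Phi (α * x)) → s ∈ integrableExpSet U ν := by
    intro s hs
    refine ((hPhi.const_mul 2).add (integrable_const 2)).mono'
      (hU.const_mul s).exp.aestronglyMeasurable (ae_of_all _ fun x => ?_)
    rw [Real.norm_of_nonneg (Real.exp_pos _).le]
    simpa [hs] using exp_le_two_mul_Phi_add_two (s * U x)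
  refine memLp_of_mem_interior_integrableExpSet (mem_interior_iff_mem_nhds.2 ?_) q
  refine Filter.mem_of_superset (Icc_mem_nhds (neg_lt_zero.2 hα) hα) ?_
  exact convex_integrableExpSet.ordConnected.out
    (hexp (-α) fun x => by rw [neg_mul, Phi_neg]) (hexp α fun _ => rfl)

/-- for `u₁, …, u_k ∈ L^Φ(p)`, the product `u₁⋯u_k` belongs to `L^r(p)`
for every `1 < r < ∞`. -/
theorem prod_mem_Lr
    {Ω : Type*} [MeasurableSpace Ω] (μ : Measure Ω) [SigmaFinite μ]
    (p : Ω → ℝ) (hp_meas : Measurable p) (hp_pos : ∀ᵐ x ∂μ, 0 < p x)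
    (hp_int : ∫⁻ x, ENNReal.ofReal (p x) ∂μ = 1)
    (k : ℕ) (hk : 1 ≤ k) (u : Fin k → Ω → ℝ) (hu_meas : ∀ i, Measurable (u i))
    (hu_mem : ∀ i, ∃ α > (0:ℝ),
      ∫⁻ x, ENNReal.ofReal (Phi (α * u i x)) ∂(densMeasure μ p) < ⊤) :
    ∀ r : ℝ, 1 < r →
      ∫⁻ x, ENNReal.ofReal (|∏ i, u i x| ^ r) ∂(densMeasure μ p) < ⊤ := by
  intro r hr
  have hr0 : 0 < r := one_pos.trans hr
  have hk0 : (k : NNReal) ≠ 0 := by positivity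
  have : IsFiniteMeasure (densMeasure μ p) :=
    isFiniteMeasure_withDensity (by rw [hp_int]; exact one_ne_top)
  have hmem : MemLp (fun x => ∏ i, u i x) (ENNReal.ofReal r) (densMeasure μ p) := by
    have h := MemLp.prod' (s := Finset.univ) (p := fun _ => ((k * r.toNNReal : NNReal) : ENNReal))
      fun i _ => by
        obtain ⟨α, hα, h⟩ := hu_mem i
        exact memLp_of_lintegral_Phi_lt_top (hu_meas i) hα h (k * r.toNNReal)
    convert h using 1
    have hr' : r.toNNReal ≠ 0 := (Real.toNNReal_pos.2 hr0).ne'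
    rw [Finset.sum_const, Finset.card_univ, Fintype.card_fin, nsmul_eq_mul, ENNReal.ofReal]
    rw [← ENNReal.coe_inv (mul_ne_zero hk0 hr'), ← ENNReal.coe_natCast, ← ENNReal.coe_mul,
      ← ENNReal.coe_inv (by positivity)]
    congr 1
    field_simp
  have h := lintegral_rpow_enorm_lt_top_of_eLpNorm_lt_top
    (ENNReal.ofReal_pos.2 hr0).ne' ofReal_ne_top hmem.eLpNorm_lt_top
  rw [toReal_ofReal hr0.le] at h
  simpa only [← ofReal_rpow_of_nonneg (abs_nonneg _) hr0.le, ← Real.enorm_eq_ofReal_abs] using h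
end

section
/- Let (Ω, F, μ) be a σ-finite measure space and p, q two densities (each measurable, positive μ-a.e., integrating to 1). Then p and q are connected by an open exponential arc if and only if there exists ε > 0 such that ∫ (q/p)^{1+ε} p dμ < ∞ and ∫ (p/q)^{1+ε} q dμ < ∞. -/
open MeasureTheory ENNReal

/-- `p` and `q` are connected by an open exponential arc: for some open interval `I ⊇ [0,1]`,
`∫ p^{1−t} q^t dμ < ∞` for all `t ∈ I`. -/
def ExpArcConnected {Ω : Type*} [MeasurableSpace Ω] (μ : Measure Ω) (p q : Ω → ℝ) : Prop :=
  ∃ I : Set ℝ, IsOpen I ∧ Set.Icc (0:ℝ) 1 ⊆ I ∧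
    ∀ t ∈ I, ∫⁻ x, ENNReal.ofReal (p x ^ (1 - t) * q x ^ t) ∂μ < ⊤

/-- The integrand of the exponential arc as a power of the likelihood ratio. -/
theorem rpow_one_sub_mul_rpow_eq {a b : ℝ} (ha : 0 < a) (hb : 0 < b) (t : ℝ) :
    a ^ (1 - t) * b ^ t = (b / a) ^ t * a := by
  rw [Real.div_rpow hb.le ha.le, Real.rpow_sub ha, Real.rpow_one]
  ring

/-- The integrand of the exponential arc at an intermediate parameter is bounded by the sum of its
values at the two endpoints. -/
theorem rpow_one_sub_mul_rpow_le_add {a b s t u : ℝ} (ha : 0 < a) (hb : 0 < b)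
    (hst : s ≤ t) (htu : t ≤ u) :
    a ^ (1 - t) * b ^ t ≤ a ^ (1 - s) * b ^ s + a ^ (1 - u) * b ^ u := by
  simp only [rpow_one_sub_mul_rpow_eq ha hb]
  rw [← add_mul]
  have hr : 0 < b / a := div_pos hb ha
  refine mul_le_mul_of_nonneg_right ?_ ha.le
  rcases le_total (b / a) 1 with h | h
  · exact le_add_of_le_of_nonneg (Real.rpow_le_rpow_of_exponent_ge hr h hst) (by positivity)
  · exact le_add_of_nonneg_of_le (by positivity) (Real.rpow_le_rpow_of_exponent_le h htu)

/-- two densities `p`, `q` are connected by an open exponential arc if and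
only if `∫ (q/p)^{1+ε} p dμ < ∞` and `∫ (p/q)^{1+ε} q dμ < ∞` for some `ε > 0`. -/
theorem expArcConnected_iff_moments
    {Ω : Type*} [MeasurableSpace Ω] (μ : Measure Ω) [SigmaFinite μ]
    (p q : Ω → ℝ)
    (hp_meas : Measurable p) (hp_pos : ∀ᵐ x ∂μ, 0 < p x)
    (hp_int : ∫⁻ x, ENNReal.ofReal (p x) ∂μ = 1)
    (hq_meas : Measurable q) (hq_pos : ∀ᵐ x ∂μ, 0 < q x)
    (hq_int : ∫⁻ x, ENNReal.ofReal (q x) ∂μ = 1) :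
    ExpArcConnected μ p q ↔
      ∃ ε > (0:ℝ),
        ∫⁻ x, ENNReal.ofReal ((q x / p x) ^ (1 + ε) * p x) ∂μ < ⊤ ∧
        ∫⁻ x, ENNReal.ofReal ((p x / q x) ^ (1 + ε) * q x) ∂μ < ⊤ := by
  have hu : ∀ ε : ℝ, ∫⁻ x, ENNReal.ofReal ((q x / p x) ^ (1 + ε) * p x) ∂μ
      = ∫⁻ x, ENNReal.ofReal (p x ^ (1 - (1 + ε)) * q x ^ (1 + ε)) ∂μ := fun ε => by
    refine lintegral_congr_ae ?_
    filter_upwards [hp_pos, hq_pos] with x hp hq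
    rw [rpow_one_sub_mul_rpow_eq hp hq]
  have hl : ∀ ε : ℝ, ∫⁻ x, ENNReal.ofReal ((p x / q x) ^ (1 + ε) * q x) ∂μ
      = ∫⁻ x, ENNReal.ofReal (p x ^ (1 - -ε) * q x ^ (-ε)) ∂μ := fun ε => by
    refine lintegral_congr_ae ?_
    filter_upwards [hp_pos, hq_pos] with x hp hq
    rw [← rpow_one_sub_mul_rpow_eq hq hp, mul_comm, sub_neg_eq_add, sub_add_cancel_left]
  simp only [hu, hl]
  constructor
  · rintro ⟨I, hI, hsub, hfin⟩
    obtain ⟨δ₀, hδ₀, h₀⟩ := Metric.isOpen_iff.1 hI 0 (hsub (by simp))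
    obtain ⟨δ₁, hδ₁, h₁⟩ := Metric.isOpen_iff.1 hI 1 (hsub (by simp))
    have hε : 0 < min δ₀ δ₁ / 2 := by positivity
    have hε₀ : min δ₀ δ₁ / 2 < δ₀ := by linarith [min_le_left δ₀ δ₁]
    have hε₁ : min δ₀ δ₁ / 2 < δ₁ := by linarith [min_le_right δ₀ δ₁]
    refine ⟨min δ₀ δ₁ / 2, hε, hfin _ (h₁ ?_), hfin _ (h₀ ?_)⟩
    · rwa [Metric.mem_ball, Real.dist_eq, add_sub_cancel_left, abs_of_pos hε]
    · rwa [Metric.mem_ball, Real.dist_eq, sub_zero, abs_neg, abs_of_pos hε]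
  · rintro ⟨ε, hε, hupper, hlower⟩
    refine ⟨Set.Ioo (-ε) (1 + ε), isOpen_Ioo,
      fun t ht => ⟨by linarith [ht.1], by linarith [ht.2]⟩, fun t ht => ?_⟩
    calc ∫⁻ x, ENNReal.ofReal (p x ^ (1 - t) * q x ^ t) ∂μ
        ≤ ∫⁻ x, (ENNReal.ofReal (p x ^ (1 - -ε) * q x ^ (-ε))
            + ENNReal.ofReal (p x ^ (1 - (1 + ε)) * q x ^ (1 + ε))) ∂μ := by
          refine lintegral_mono_ae ?_
          filter_upwards [hp_pos, hq_pos] with x hp hq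
          rw [← ENNReal.ofReal_add (by positivity) (by positivity)]
          exact ENNReal.ofReal_le_ofReal
            (rpow_one_sub_mul_rpow_le_add hp hq ht.1.le ht.2.le)
      _ = ∫⁻ x, ENNReal.ofReal (p x ^ (1 - -ε) * q x ^ (-ε)) ∂μ
            + ∫⁻ x, ENNReal.ofReal (p x ^ (1 - (1 + ε)) * q x ^ (1 + ε)) ∂μ :=
          lintegral_add_left (by fun_prop) _
      _ < ⊤ := ENNReal.add_lt_top.2 ⟨hlower, hupper⟩
end

section
/- Let (Ω, F, μ) be a σ-finite measure space and p, q two densities. Then p and q are connected by an open exponential arc if and only if the Orlicz spaces L^Φ(p) and L^Φ(q) coincide as sets, i.e. if and only if for every measurable U: (∃ α > 0 with ∫ (cosh(αU) − 1) p dμ < ∞) ⇔ (∃ α > 0 with ∫ (cosh(αU) − 1) q dμ < ∞). -/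
open MeasureTheory ENNReal

section Helpers

variable {Ω : Type*} [MeasurableSpace Ω] {μ : Measure Ω}

lemma lintegral_ofReal_lt_top_of_le_mul_add {f g h : Ω → ℝ} {C : ℝ} (hC : 0 ≤ C)
    (hg : Measurable g) (hle : ∀ᵐ x ∂μ, f x ≤ C * (g x + h x))
    (hgi : ∫⁻ x, ENNReal.ofReal (g x) ∂μ < ⊤) (hhi : ∫⁻ x, ENNReal.ofReal (h x) ∂μ < ⊤) :
    ∫⁻ x, ENNReal.ofReal (f x) ∂μ < ⊤ := by
  calc ∫⁻ x, ENNReal.ofReal (f x) ∂μ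
      ≤ ∫⁻ x, ENNReal.ofReal C * (ENNReal.ofReal (g x) + ENNReal.ofReal (h x)) ∂μ := by
        refine lintegral_mono_ae ?_
        filter_upwards [hle] with x hx
        refine (ENNReal.ofReal_le_ofReal hx).trans ?_
        rw [ENNReal.ofReal_mul hC]
        gcongr
        exact ENNReal.ofReal_add_le
    _ = ENNReal.ofReal C *
          (∫⁻ x, ENNReal.ofReal (g x) ∂μ + ∫⁻ x, ENNReal.ofReal (h x) ∂μ) := by
        rw [lintegral_const_mul' _ _ ENNReal.ofReal_ne_top, lintegral_add_left hg.ennreal_ofReal]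
    _ < ⊤ := ENNReal.mul_lt_top ENNReal.ofReal_lt_top (ENNReal.add_lt_top.2 ⟨hgi, hhi⟩)

lemma exp_abs_le_two_mul_cosh (x : ℝ) : Real.exp |x| ≤ 2 * Real.cosh x := by
  rw [← Real.cosh_abs, Real.cosh_eq]
  linarith [Real.exp_pos (-|x|)]

lemma cosh_le_exp_abs (x : ℝ) : Real.cosh x ≤ Real.exp |x| := by
  rw [← Real.cosh_abs, Real.cosh_eq]
  have : Real.exp (-|x|) ≤ Real.exp |x| := Real.exp_le_exp.2 (by linarith [abs_nonneg x])
  linarith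

lemma mul_le_rpow_add_rpow {a b ε : ℝ} (ha : 0 < a) (hb : 0 < b) (hε : 0 < ε) :
    a * b ≤ a ^ (1 + 1 / ε) + b ^ (1 + ε) := by
  rw [Real.rpow_add ha, Real.rpow_add hb, Real.rpow_one, Real.rpow_one]
  have ha' : 0 < a ^ (1 / ε) := Real.rpow_pos_of_pos ha _
  have hb' : 0 < b ^ ε := Real.rpow_pos_of_pos hb _
  rcases le_total a (b ^ ε) with h | h
  · nlinarith [mul_pos ha ha']
  · have h2 : b ≤ a ^ (1 / ε) := by
      have := Real.rpow_le_rpow hb'.le h (by positivity : (0:ℝ) ≤ 1 / ε)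
      rwa [← Real.rpow_mul hb.le, mul_one_div_cancel hε.ne', Real.rpow_one] at this
    nlinarith [mul_pos hb hb']

lemma mul_div_rpow {a b : ℝ} (ha : 0 < a) (hb : 0 < b) (t : ℝ) :
    a * (b / a) ^ t = a ^ (1 - t) * b ^ t := by
  rw [Real.div_rpow hb.le ha.le, Real.rpow_sub ha, Real.rpow_one]
  ring

lemma exists_lintegral_cosh_lt_top_of_rpow {p q U : Ω → ℝ} {ε : ℝ} (hε : 0 < ε)
    (hp_meas : Measurable p) (hp_pos : ∀ᵐ x ∂μ, 0 < p x)
    (hp_int : ∫⁻ x, ENNReal.ofReal (p x) ∂μ < ⊤) (hq_pos : ∀ᵐ x ∂μ, 0 < q x)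
    (hU : Measurable U)
    (hpq : ∫⁻ x, ENNReal.ofReal (p x ^ (1 - (1 + ε)) * q x ^ (1 + ε)) ∂μ < ⊤)
    (h : ∃ α > (0:ℝ), ∫⁻ x, ENNReal.ofReal ((Real.cosh (α * U x) - 1) * p x) ∂μ < ⊤) :
    ∃ α > (0:ℝ), ∫⁻ x, ENNReal.ofReal ((Real.cosh (α * U x) - 1) * q x) ∂μ < ⊤ := by
  obtain ⟨α, hα, h⟩ := h
  have hexp : ∫⁻ x, ENNReal.ofReal (Real.exp |α * U x| * p x) ∂μ < ⊤ := by
    refine lintegral_ofReal_lt_top_of_le_mul_add (C := 2) zero_le_two hp_meas ?_ hp_int h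
    filter_upwards [hp_pos] with x hx
    nlinarith [exp_abs_le_two_mul_cosh (α * U x)]
  have hk : 0 < 1 + 1 / ε := by positivity
  refine ⟨α / (1 + 1 / ε), by positivity, ?_⟩
  refine lintegral_ofReal_lt_top_of_le_mul_add (C := 1) zero_le_one
    (by fun_prop) ?_ hexp hpq
  filter_upwards [hp_pos, hq_pos] with x hp hq
  have hy := mul_le_rpow_add_rpow (Real.exp_pos |α / (1 + 1 / ε) * U x|) (div_pos hq hp) hε
  rw [← Real.exp_mul] at hy
  have he : |α / (1 + 1 / ε) * U x| * (1 + 1 / ε) = |α * U x| := by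
    rw [abs_mul, abs_mul, abs_div, abs_of_pos hk]
    field_simp
  rw [he] at hy
  have hq' : p x * (q x / p x) = q x := mul_div_cancel₀ _ hp.ne'
  rw [← mul_div_rpow hp hq]
  have hc := cosh_le_exp_abs (α / (1 + 1 / ε) * U x)
  calc (Real.cosh (α / (1 + 1 / ε) * U x) - 1) * q x
      ≤ Real.exp |α / (1 + 1 / ε) * U x| * q x := by gcongr; linarith
    _ = p x * (Real.exp |α / (1 + 1 / ε) * U x| * (q x / p x)) := by
        rw [mul_left_comm, hq']
    _ ≤ p x * (Real.exp |α * U x| + (q x / p x) ^ (1 + ε)) := by gcongr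
    _ = _ := by ring

lemma exists_lintegral_rpow_lt_top_of_orlicz_subset {p q : Ω → ℝ}
    (hp_meas : Measurable p) (hp_pos : ∀ᵐ x ∂μ, 0 < p x)
    (hp_int : ∫⁻ x, ENNReal.ofReal (p x) ∂μ < ⊤)
    (hq_meas : Measurable q) (hq_pos : ∀ᵐ x ∂μ, 0 < q x)
    (hq_int : ∫⁻ x, ENNReal.ofReal (q x) ∂μ < ⊤)
    (h : ∀ U : Ω → ℝ, Measurable U →
      (∃ α > (0:ℝ), ∫⁻ x, ENNReal.ofReal ((Real.cosh (α * U x) - 1) * p x) ∂μ < ⊤) →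
      (∃ α > (0:ℝ), ∫⁻ x, ENNReal.ofReal ((Real.cosh (α * U x) - 1) * q x) ∂μ < ⊤)) :
    ∃ ε > (0:ℝ), ∫⁻ x, ENNReal.ofReal (p x ^ (1 - (1 + ε)) * q x ^ (1 + ε)) ∂μ < ⊤ := by
  obtain ⟨α, hα, hα'⟩ := h (fun x => max (Real.log (q x / p x)) 0) (by fun_prop) ⟨1, one_pos, by
    refine lintegral_ofReal_lt_top_of_le_mul_add (C := 1) zero_le_one hp_meas ?_ hp_int hq_int
    filter_upwards [hp_pos, hq_pos] with x hp hq
    have hc := cosh_le_exp_abs (max (Real.log (q x / p x)) 0)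
    rw [abs_of_nonneg (le_max_right _ _)] at hc
    have he : Real.exp (max (Real.log (q x / p x)) 0) ≤ q x / p x + 1 := by
      rcases max_choice (Real.log (q x / p x)) 0 with h | h <;> rw [h]
      · rw [Real.exp_log (div_pos hq hp)]; linarith
      · rw [Real.exp_zero]; linarith [div_pos hq hp]
    have hq' : q x / p x * p x = q x := div_mul_cancel₀ _ hp.ne'
    rw [one_mul]
    nlinarith⟩
  refine ⟨α, hα, ?_⟩
  refine lintegral_ofReal_lt_top_of_le_mul_add (C := 2) zero_le_two hq_meas ?_ hq_int hα'
  filter_upwards [hp_pos, hq_pos] with x hp hq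
  have hc := exp_abs_le_two_mul_cosh (α * max (Real.log (q x / p x)) 0)
  have he : (q x / p x) ^ α ≤ Real.exp |α * max (Real.log (q x / p x)) 0| := by
    rw [Real.rpow_def_of_pos (div_pos hq hp), mul_comm]
    refine Real.exp_le_exp.2 (le_trans ?_ (le_abs_self _))
    gcongr
    exact le_max_left _ _
  have hq' : p x * (q x / p x) = q x := mul_div_cancel₀ _ hp.ne'
  rw [← mul_div_rpow hp hq, Real.rpow_add (div_pos hq hp), Real.rpow_one, ← mul_assoc, hq']
  nlinarith

lemma rpow_le_rpow_add_rpow {r s t u : ℝ} (hr : 0 < r) (hs : s ≤ t) (hu : t ≤ u) :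
    r ^ t ≤ r ^ s + r ^ u := by
  have h1 := Real.rpow_pos_of_pos hr s
  have h2 := Real.rpow_pos_of_pos hr u
  rcases le_total r 1 with h | h
  · linarith [Real.rpow_le_rpow_of_exponent_ge hr h hs]
  · linarith [Real.rpow_le_rpow_of_exponent_le h hu]

end Helpers

/-- `p ⌣ q` iff the Orlicz spaces `L^Φ(p)` and `L^Φ(q)` coincide as sets,
where `Φ = cosh − 1`. -/
theorem expArcConnected_iff_orlicz_eq
    {Ω : Type*} [MeasurableSpace Ω] (μ : Measure Ω) [SigmaFinite μ]
    (p q : Ω → ℝ)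
    (hp_meas : Measurable p) (hp_pos : ∀ᵐ x ∂μ, 0 < p x)
    (hp_int : ∫⁻ x, ENNReal.ofReal (p x) ∂μ = 1)
    (hq_meas : Measurable q) (hq_pos : ∀ᵐ x ∂μ, 0 < q x)
    (hq_int : ∫⁻ x, ENNReal.ofReal (q x) ∂μ = 1) :
    ExpArcConnected μ p q ↔
      ∀ U : Ω → ℝ, Measurable U →
        ((∃ α > (0:ℝ), ∫⁻ x, ENNReal.ofReal ((Real.cosh (α * U x) - 1) * p x) ∂μ < ⊤) ↔
         (∃ α > (0:ℝ), ∫⁻ x, ENNReal.ofReal ((Real.cosh (α * U x) - 1) * q x) ∂μ < ⊤)) := by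
  have hp_fin : ∫⁻ x, ENNReal.ofReal (p x) ∂μ < ⊤ := hp_int ▸ ENNReal.one_lt_top
  have hq_fin : ∫⁻ x, ENNReal.ofReal (q x) ∂μ < ⊤ := hq_int ▸ ENNReal.one_lt_top
  have hswap (ε : ℝ) : ∫⁻ x, ENNReal.ofReal (q x ^ (1 - (1 + ε)) * p x ^ (1 + ε)) ∂μ =
      ∫⁻ x, ENNReal.ofReal (p x ^ (1 - -ε) * q x ^ (-ε)) ∂μ := by
    refine lintegral_congr fun x => ?_
    rw [mul_comm, sub_neg_eq_add, sub_add_cancel_left]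
  constructor
  · rintro ⟨I, hI, hsub, hfin⟩ U hU
    obtain ⟨δ, hδ, hδI⟩ := Metric.isOpen_iff.1 hI 0 (hsub (by simp))
    obtain ⟨ε, hε, hεI⟩ := Metric.isOpen_iff.1 hI 1 (hsub (by simp))
    constructor
    · refine exists_lintegral_cosh_lt_top_of_rpow (half_pos hε) hp_meas hp_pos hp_fin hq_pos hU
        (hfin _ (hεI ?_))
      simp [abs_of_pos hε, hε]
    · refine exists_lintegral_cosh_lt_top_of_rpow (half_pos hδ) hq_meas hq_pos hq_fin hp_pos hU ?_
      rw [hswap]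
      refine hfin _ (hδI ?_)
      simp [abs_of_pos hδ, hδ]
  · intro h
    obtain ⟨ε, hε, hε'⟩ := exists_lintegral_rpow_lt_top_of_orlicz_subset hp_meas hp_pos hp_fin
      hq_meas hq_pos hq_fin fun U hU => (h U hU).1
    obtain ⟨δ, hδ, hδ'⟩ := exists_lintegral_rpow_lt_top_of_orlicz_subset hq_meas hq_pos hq_fin
      hp_meas hp_pos hp_fin fun U hU => (h U hU).2
    rw [hswap] at hδ'
    refine ⟨Set.Ioo (-δ) (1 + ε), isOpen_Ioo, fun t ht => ⟨?_, ?_⟩, fun t ht => ?_⟩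
    · linarith [ht.1]
    · linarith [ht.2]
    · refine lintegral_ofReal_lt_top_of_le_mul_add (C := 1) zero_le_one (by fun_prop) ?_ hδ' hε'
      filter_upwards [hp_pos, hq_pos] with x hp hq
      simp only [← mul_div_rpow hp hq]
      rw [one_mul, ← mul_add]
      gcongr
      exact rpow_le_rpow_add_rpow (div_pos hq hp) ht.1.le ht.2.le
end

section
/- Let (Ω, F, μ) be a σ-finite measure space, p a density, and u, v measurable functions with ∫ u p dμ = ∫ v p dμ = 0. Assume there exists δ > 0 such that ∫ e^{u + t v} p dμ < ∞ for all t ∈ (−δ, δ). Let q = e^{u − K_p(u)} p with K_p(u) = log ∫ e^u p dμ. Then the map t ↦ K_p(u + t v) = log ∫ e^{u + t v} p dμ is differentiable at t = 0 with derivative equal to E_q[v] = ∫ v e^{u} p dμ / ∫ e^{u} p dμ. In particular the Gâteaux derivative of the cumulant generating functional at u in the direction v equals the expectation of v under q. -/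
open MeasureTheory ENNReal

/-- Integration against the measure `e^u · ν`. -/
lemma integral_withDensity_exp {Ω : Type*} [MeasurableSpace Ω] {ν : Measure Ω} {u : Ω → ℝ}
    (hu : Measurable u) (f : Ω → ℝ) :
    ∫ x, f x ∂(ν.withDensity fun x => ENNReal.ofReal (Real.exp (u x))) =
      ∫ x, f x * Real.exp (u x) ∂ν := by
  rw [integral_withDensity_eq_integral_toReal_smul (by fun_prop) (by simp)]
  simp [ENNReal.toReal_ofReal, Real.exp_nonneg, mul_comm]

lemma integrable_withDensity_exp_iff {Ω : Type*} [MeasurableSpace Ω] {ν : Measure Ω} {u : Ω → ℝ}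
    (hu : Measurable u) (f : Ω → ℝ) :
    Integrable f (ν.withDensity fun x => ENNReal.ofReal (Real.exp (u x))) ↔
      Integrable (fun x => f x * Real.exp (u x)) ν := by
  rw [integrable_withDensity_iff_integrable_smul' (by fun_prop) (by simp)]
  simp [ENNReal.toReal_ofReal, Real.exp_nonneg, mul_comm]

/-- The logarithm of `t ↦ ∫ e^{u + t v} dν` has derivative `∫ v e^u dν / ∫ e^u dν` at `0`. -/
lemma hasDerivAt_log_integral_exp_add_mul {Ω : Type*} [MeasurableSpace Ω] {ν : Measure Ω}
    [NeZero ν] {u v : Ω → ℝ} (hu : Measurable u)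
    (h : ∀ᶠ t in nhds (0 : ℝ), Integrable (fun x => Real.exp (u x + t * v x)) ν) :
    HasDerivAt (fun t : ℝ => Real.log (∫ x, Real.exp (u x + t * v x) ∂ν))
      ((∫ x, v x * Real.exp (u x) ∂ν) / (∫ x, Real.exp (u x) ∂ν)) 0 := by
  set κ := ν.withDensity fun x => ENNReal.ofReal (Real.exp (u x)) with hκ
  have hmgf (t : ℝ) : ProbabilityTheory.mgf v κ t = ∫ x, Real.exp (u x + t * v x) ∂ν := by
    simp_rw [ProbabilityTheory.mgf, hκ, integral_withDensity_exp hu, Real.exp_add, mul_comm]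
  have hmem : (0 : ℝ) ∈ interior (ProbabilityTheory.integrableExpSet v κ) := by
    rw [mem_interior_iff_mem_nhds]
    filter_upwards [h] with t ht
    refine (integrable_withDensity_exp_iff hu _).2 (ht.congr (.of_forall fun x => ?_))
    simp only [Real.exp_add, mul_comm]
  have hpos : 0 < ∫ x, Real.exp (u x) ∂ν :=
    integral_exp_pos (by simpa using h.self_of_nhds)
  have hderiv := ProbabilityTheory.hasDerivAt_mgf hmem
  simp_rw [hκ, integral_withDensity_exp hu, ← hκ, zero_mul, Real.exp_zero, mul_one] at hderiv
  have hzero : ProbabilityTheory.mgf v κ 0 = ∫ x, Real.exp (u x) ∂ν := by simp [hmgf]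
  have hlog := hderiv.log (hzero ▸ hpos.ne')
  rwa [hzero, funext hmgf] at hlog

/-- the map `t ↦ K_p(u + t v) = log ∫ e^{u + t v} p dμ` is differentiable
at `t = 0` with derivative `E_q[v] = ∫ v e^u p dμ / ∫ e^u p dμ`, where
`q = e^{u − K_p(u)} p`. -/
theorem cumulant_gateaux_derivative
    {Ω : Type*} [MeasurableSpace Ω] (μ : Measure Ω) [SigmaFinite μ]
    (p : Ω → ℝ) (hp_meas : Measurable p) (hp_pos : ∀ᵐ x ∂μ, 0 < p x)
    (hp_int : ∫⁻ x, ENNReal.ofReal (p x) ∂μ = 1)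
    (u v : Ω → ℝ) (hu_meas : Measurable u) (hv_meas : Measurable v)
    (hu_zero : ∫ x, u x ∂(densMeasure μ p) = 0)
    (hv_zero : ∫ x, v x ∂(densMeasure μ p) = 0)
    (hδ : ∃ δ > (0:ℝ), ∀ t ∈ Set.Ioo (-δ) δ,
      ∫⁻ x, ENNReal.ofReal (Real.exp (u x + t * v x)) ∂(densMeasure μ p) < ⊤) :
    HasDerivAt
      (fun t : ℝ =>
        Real.log ((∫⁻ x, ENNReal.ofReal (Real.exp (u x + t * v x)) ∂(densMeasure μ p)).toReal))
      ((∫ x, v x * Real.exp (u x) ∂(densMeasure μ p)) /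
        (∫ x, Real.exp (u x) ∂(densMeasure μ p)))
      0 := by
  have : NeZero (densMeasure μ p) := ⟨fun h0 => by
    have huniv : densMeasure μ p Set.univ = 1 := by
      rw [densMeasure, withDensity_apply _ MeasurableSet.univ, setLIntegral_univ, hp_int]
    simp [h0] at huniv⟩
  obtain ⟨δ, hδ_pos, hfin⟩ := hδ
  have hint : ∀ᶠ t in nhds (0 : ℝ),
      Integrable (fun x => Real.exp (u x + t * v x)) (densMeasure μ p) := by
    filter_upwards [Ioo_mem_nhds (neg_lt_zero.2 hδ_pos) hδ_pos] with t ht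
    refine ⟨by fun_prop, ?_⟩
    rw [hasFiniteIntegral_iff_ofReal (.of_forall fun x => Real.exp_nonneg _)]
    exact hfin t ht
  convert hasDerivAt_log_integral_exp_add_mul hu_meas hint using 3 with t
  exact (integral_eq_lintegral_of_nonneg_ae (.of_forall fun x => Real.exp_nonneg _)
    (by fun_prop)).symm
end

section
/- Let M be the standard Gaussian density on ℝ³ and let b : ℝ³ × ℝ³ → [0, ∞) be measurable with C|u − v|^λ ≤ b(u, v) ≤ A + B|u − v|² for all u, v ∈ ℝ³, for some constants A ∈ ℝ and B, C, λ > 0. Let f, g be probability densities on ℝ³ each connected to M by an open exponential arc. Then 0 < ∬ b(u,v) f(u) g(v) du dv < ∞, and there exists ε > 0 such that ∬ b(u,v)^{1+ε} f(u) g(v) du dv < ∞ and ∬ b(u,v)^{−ε} f(u) g(v) du dv < ∞; consequently the normalized density (u,v) ↦ b(u,v) f(u) g(v) / ∬ b f⊗g is connected to f ⊗ g (and hence to M ⊗ M) by an open exponential arc. -/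
open MeasureTheory ENNReal

/-- The standard Gaussian (Maxwell) density on `ℝ³`. -/
noncomputable def gaussE (x : EuclideanSpace ℝ (Fin 3)) : ℝ :=
  (2 * Real.pi) ^ (-(3 : ℝ) / 2) * Real.exp (-‖x‖ ^ 2 / 2)

lemma rpow_le_one_add_rpow_add_rpow {y : ℝ} (hy : 0 ≤ y) {s r c : ℝ} (hr : r ≤ s) (hc : s ≤ c) :
    y ^ s ≤ 1 + y ^ c + y ^ r := by
  have hyc := Real.rpow_nonneg hy c
  have hyr := Real.rpow_nonneg hy r
  rcases hy.eq_or_lt with rfl | hy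
  · have : (0 : ℝ) ^ s ≤ 1 := Real.zero_rpow_le_one s
    linarith
  · rcases le_total y 1 with h | h
    · have := Real.rpow_le_rpow_of_exponent_ge hy h hr
      linarith
    · have := Real.rpow_le_rpow_of_exponent_le h hc
      linarith

/-- If `b` has all positive moments and some negative moment with respect to the density `m`, and
`m`, `F` are connected by an exponential arc reaching slightly beyond both endpoints, then the
mixed moments `∫ b^s F^t m^{1-t}` are finite for all `s`, `t` in a neighbourhood of `[0,1]`. -/
lemma exists_integrable_rpow_mul_rpow_mul_rpow {Ω : Type*} [MeasurableSpace Ω] {ν : Measure Ω}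
    {b F m : Ω → ℝ} (hb : Measurable b) (hF : Measurable F) (hm : Measurable m)
    (hb0 : ∀ x, 0 ≤ b x) (hF0 : ∀ᵐ x ∂ν, 0 < F x) (hm0 : ∀ x, 0 < m x)
    {a δ : ℝ} (ha : 0 < a) (hδ : 0 < δ) (hm_int : Integrable m ν)
    (hb_pos : ∀ N : ℝ, 0 ≤ N → Integrable (fun x => b x ^ N * m x) ν)
    (hb_neg : Integrable (fun x => b x ^ (-a) * m x) ν)
    (hF_pos : Integrable (fun x => m x ^ (1 - (1 + δ)) * F x ^ (1 + δ)) ν)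
    (hF_neg : Integrable (fun x => m x ^ (1 - (-δ)) * F x ^ (-δ)) ν) :
    ∃ ε > (0 : ℝ), ∀ s ∈ Set.Icc (-ε) (1 + ε), ∀ t ∈ Set.Icc (-ε) (1 + ε),
      Integrable (fun x => b x ^ s * (F x ^ t * m x ^ (1 - t))) ν := by
  set p : ℝ := (1 + δ) / (1 + δ / 2) with hp
  set q : ℝ := (1 + δ) / (δ / 2) with hq
  have hp0 : 0 < p := by positivity
  have hq0 : 0 < q := by positivity
  have hp1 : 1 ≤ p := by rw [hp, le_div_iff₀ (by positivity)]; linarith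
  have hq1 : 1 ≤ q := by rw [hq, le_div_iff₀ (by positivity)]; linarith
  have hpq : p.HolderConjugate q := by
    rw [Real.holderConjugate_iff]
    refine ⟨by rw [hp, lt_div_iff₀ (by positivity)]; linarith, ?_⟩
    rw [hp, hq]; field_simp; ring
  have hpδ : (1 + δ / 2) * p = 1 + δ := by rw [hp]; field_simp
  refine ⟨min (min (δ / 2) (a / q)) 1, by positivity, ?_⟩
  set ε := min (min (δ / 2) (a / q)) 1 with hε
  have hε1 : ε ≤ δ / 2 := (min_le_left _ _).trans (min_le_left _ _)
  have hε2 : ε * q ≤ a := (le_div_iff₀ hq0).1 ((min_le_left _ _).trans (min_le_right _ _))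
  have hε3 : ε ≤ 1 := min_le_right _ _
  rintro s ⟨hs1, hs2⟩ t ⟨ht1, ht2⟩
  have hdom : Integrable (fun x => (m x + b x ^ (2 * q) * m x + b x ^ (-a) * m x) +
      (m x + m x ^ (1 - (1 + δ)) * F x ^ (1 + δ) + m x ^ (1 - (-δ)) * F x ^ (-δ))) ν :=
    ((hm_int.add (hb_pos _ (by positivity))).add hb_neg).add ((hm_int.add hF_pos).add hF_neg)
  refine hdom.mono' (by fun_prop) ?_
  filter_upwards [hF0] with x hFx
  have hmx := hm0 x
  have hbx := hb0 x
  have hsplit : ∀ r : ℝ, m x ^ (1 - r) * F x ^ r = (F x / m x) ^ r * m x := by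
    intro r
    rw [Real.div_rpow hFx.le hmx.le, Real.rpow_sub hmx, Real.rpow_one]
    field_simp
  rw [mul_comm (F x ^ t), hsplit, hsplit, hsplit, Real.norm_of_nonneg (by positivity)]
  set X := F x / m x with hX
  have hX0 : 0 < X := by positivity
  have hyoung := Real.young_inequality_of_nonneg (Real.rpow_nonneg hX0.le t)
    (Real.rpow_nonneg hbx s) hpq
  rw [← Real.rpow_mul hX0.le, ← Real.rpow_mul hbx] at hyoung
  have hXp : X ^ (t * p) / p ≤ X ^ (t * p) := div_le_self (by positivity) hp1
  have hbq : b x ^ (s * q) / q ≤ b x ^ (s * q) := div_le_self (by positivity) hq1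
  have hX1 : X ^ (t * p) ≤ 1 + X ^ (1 + δ) + X ^ (-δ) := by
    apply rpow_le_one_add_rpow_add_rpow hX0.le <;> nlinarith
  have hb1 : b x ^ (s * q) ≤ 1 + b x ^ (2 * q) + b x ^ (-a) := by
    apply rpow_le_one_add_rpow_add_rpow hbx <;> nlinarith
  have : X ^ t * b x ^ s ≤
      (1 + b x ^ (2 * q) + b x ^ (-a)) + (1 + X ^ (1 + δ) + X ^ (-δ)) := by linarith
  have := mul_le_mul_of_nonneg_right this hmx.le
  linarith

lemma ExpArcConnected.exists_integrable {Ω : Type*} [MeasurableSpace Ω] {μ : Measure Ω}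
    {p q : Ω → ℝ} (h : ExpArcConnected μ p q) (hp : Measurable p) (hq : Measurable q)
    (hp0 : ∀ᵐ x ∂μ, 0 < p x) (hq0 : ∀ᵐ x ∂μ, 0 < q x) :
    ∃ δ > (0 : ℝ), ∀ t ∈ Set.Icc (-δ) (1 + δ), Integrable (fun x => p x ^ (1 - t) * q x ^ t) μ := by
  obtain ⟨I, hI, hsub, hfin⟩ := h
  obtain ⟨δ, hδ, hthick⟩ := isCompact_Icc.exists_cthickening_subset_open hI hsub
  refine ⟨δ, hδ, fun t ht => ?_⟩
  have htI : t ∈ I := by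
    apply hthick
    refine Metric.mem_cthickening_of_dist_le t (max 0 (min 1 t)) δ _ ⟨by simp, by simp⟩ ?_
    rw [Real.dist_eq, abs_le]
    obtain ⟨ht0, ht1⟩ := ht
    constructor <;> rcases max_cases 0 (min 1 t) with h | h <;>
      rcases min_cases 1 t with h' | h' <;> linarith
  refine (lintegral_ofReal_ne_top_iff_integrable (by fun_prop) ?_).1 (hfin t htI).ne
  filter_upwards [hp0, hq0] with x hpx hqx
  simp only [Pi.zero_apply]
  positivity

local notation "E3" => EuclideanSpace ℝ (Fin 3)

lemma gaussE_pos (x : E3) : 0 < gaussE x := by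
  unfold gaussE; positivity

lemma measurable_gaussE : Measurable gaussE := by
  unfold gaussE; fun_prop

lemma integrable_exp_neg_mul_norm_sq {c : ℝ} (hc : 0 < c) :
    Integrable (fun x : E3 => Real.exp (-c * ‖x‖ ^ 2)) := by
  have h := (GaussianFourier.integrable_cexp_neg_mul_sq_norm_add (V := E3) (b := (c : ℂ))
    (by simpa using hc) 0 0).norm
  refine h.congr (Filter.Eventually.of_forall fun x => ?_)
  have : -(c : ℂ) * (‖x‖ : ℂ) ^ 2 + 0 * (inner ℝ (0 : E3) x : ℂ) = ((-c * ‖x‖ ^ 2 : ℝ) : ℂ) := by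
    push_cast; ring
  simp only [this, Complex.norm_exp, Complex.ofReal_re]

lemma gaussE_le_exp (x : E3) : gaussE x ≤ Real.exp (-(1 / 2) * ‖x‖ ^ 2) := by
  have h : (2 * Real.pi) ^ (-(3 : ℝ) / 2) ≤ 1 :=
    Real.rpow_le_one_of_one_le_of_nonpos (by linarith [Real.pi_gt_three]) (by norm_num)
  calc gaussE x ≤ 1 * Real.exp (-‖x‖ ^ 2 / 2) := by unfold gaussE; gcongr
    _ = _ := by rw [one_mul]; congr 1; ring

lemma gaussE_le_one (x : E3) : gaussE x ≤ 1 :=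
  (gaussE_le_exp x).trans (Real.exp_le_one_iff.2 (by nlinarith [sq_nonneg ‖x‖]))

lemma integrable_exp_mul_gaussE {c : ℝ} (hc : c < 1 / 2) :
    Integrable (fun x : E3 => Real.exp (c * ‖x‖ ^ 2) * gaussE x) := by
  refine (integrable_exp_neg_mul_norm_sq (sub_pos.2 hc)).mono'
    (by have := measurable_gaussE; fun_prop) (Filter.Eventually.of_forall fun x => ?_)
  have := gaussE_pos x
  rw [Real.norm_of_nonneg (by positivity)]
  calc _ ≤ Real.exp (c * ‖x‖ ^ 2) * Real.exp (-(1 / 2) * ‖x‖ ^ 2) := by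
        gcongr; exact gaussE_le_exp x
    _ = _ := by rw [← Real.exp_add]; congr 1; ring

lemma integrable_gaussE : Integrable gaussE := by
  simpa using integrable_exp_mul_gaussE (c := 0) (by norm_num)

lemma integrable_gaussE_mul_gaussE :
    Integrable (fun z : E3 × E3 => gaussE z.1 * gaussE z.2) :=
  integrable_gaussE.mul_prod integrable_gaussE

lemma integrable_inv_norm_mul_exp :
    Integrable (fun x : E3 => ‖x‖⁻¹ * Real.exp (-1 * ‖x‖ ^ 2)) := by
  rw [integrable_fun_norm_addHaar volume (f := fun y : ℝ => y⁻¹ * Real.exp (-1 * y ^ 2))]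
  refine (integrable_mul_exp_neg_mul_sq one_pos).integrableOn.congr_fun (fun y hy => ?_)
    measurableSet_Ioi
  have : y ≠ 0 := (Set.mem_Ioi.1 hy).ne'
  simp only [finrank_euclideanSpace, Fintype.card_fin, smul_eq_mul]
  field_simp

lemma integrable_inv_norm_sub_mul_gaussE :
    Integrable (fun z : E3 × E3 => ‖z.1 - z.2‖⁻¹ * (gaussE z.1 * gaussE z.2)) := by
  have hconv := Integrable.convolution_integrand (ContinuousLinearMap.mul ℝ ℝ)
    integrable_gaussE integrable_inv_norm_mul_exp
  refine (integrable_gaussE_mul_gaussE.add (hconv.const_mul (Real.exp 1))).mono'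
    (by have := measurable_gaussE; fun_prop) (Filter.Eventually.of_forall fun z => ?_)
  have h1 := gaussE_pos z.1
  have h2 := gaussE_pos z.2
  have h3 := gaussE_le_one z.1
  rw [Real.norm_of_nonneg (by positivity)]
  simp only [Pi.add_apply, ContinuousLinearMap.mul_apply']
  set r := ‖z.1 - z.2‖
  have hr : 0 ≤ r := norm_nonneg _
  rcases le_total r 1 with h | h
  · have hexp : 1 ≤ Real.exp 1 * Real.exp (-1 * r ^ 2) := by
      rw [← Real.exp_add]; exact Real.one_le_exp (by nlinarith)
    calc r⁻¹ * (gaussE z.1 * gaussE z.2) ≤ r⁻¹ * (1 * gaussE z.2) := by gcongr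
      _ = 1 * (r⁻¹ * gaussE z.2) := by ring
      _ ≤ (Real.exp 1 * Real.exp (-1 * r ^ 2)) * (r⁻¹ * gaussE z.2) := by gcongr
      _ = 0 + Real.exp 1 * (gaussE z.2 * (r⁻¹ * Real.exp (-1 * r ^ 2))) := by ring
      _ ≤ _ := by gcongr; positivity
  · calc r⁻¹ * (gaussE z.1 * gaussE z.2) ≤ 1 * (gaussE z.1 * gaussE z.2) := by
          gcongr; exact inv_le_one_of_one_le₀ h
      _ ≤ _ := by rw [one_mul]; exact le_add_of_nonneg_right (by positivity)

lemma ae_fst_ne_snd : ∀ᵐ z : E3 × E3, z.1 ≠ z.2 := by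
  rw [Measure.volume_eq_prod]
  refine (Measure.ae_prod_iff_ae_ae ?_).2 (Filter.Eventually.of_forall fun x => ?_)
  · exact (measurableSet_eq_fun measurable_fst measurable_snd).compl
  · simpa [eq_comm] using Measure.ae_ne volume x

lemma integrable_rpow_mul_gaussE_of_le {b : E3 × E3 → ℝ} (hb : Measurable b)
    (hb0 : ∀ z, 0 ≤ b z) {A B : ℝ} (hB : 0 < B)
    (hb_up : ∀ u v : E3, b (u, v) ≤ A + B * ‖u - v‖ ^ 2) {N : ℝ} (hN : 0 ≤ N) :
    Integrable (fun z : E3 × E3 => b z ^ N * (gaussE z.1 * gaussE z.2)) := by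
  set s : ℝ := 1 / (4 * (N + 1)) with hs
  have hs0 : 0 < s := by positivity
  have hs1 : s ≤ 1 := by rw [hs, div_le_one (by positivity)]; linarith
  have hNs : s * N < 1 / 2 := by
    rw [hs, div_mul_eq_mul_div, div_lt_div_iff₀ (by positivity) (by positivity)]; linarith
  set K : ℝ := (|A| + 2 * B) / s ^ 2 with hK
  have hK0 : 0 < K := by positivity
  have hquad : ∀ x : E3, s * (1 + ‖x‖ ^ 2) ≤ Real.exp (s * ‖x‖ ^ 2) := fun x => by
    have := Real.add_one_le_exp (s * ‖x‖ ^ 2)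
    linarith
  have hbexp : ∀ z : E3 × E3, b z ≤ K * (Real.exp (s * ‖z.1‖ ^ 2) * Real.exp (s * ‖z.2‖ ^ 2)) := by
    intro z
    have h1 : ‖z.1 - z.2‖ ^ 2 ≤ 2 * ‖z.1‖ ^ 2 + 2 * ‖z.2‖ ^ 2 := by
      have := norm_sub_le z.1 z.2
      nlinarith [norm_nonneg (z.1 - z.2), sq_nonneg (‖z.1‖ - ‖z.2‖)]
    calc b z ≤ A + B * ‖z.1 - z.2‖ ^ 2 := hb_up z.1 z.2
      _ ≤ |A| + B * (2 * ‖z.1‖ ^ 2 + 2 * ‖z.2‖ ^ 2) := by gcongr; exact le_abs_self A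
      _ ≤ (|A| + 2 * B) * ((1 + ‖z.1‖ ^ 2) * (1 + ‖z.2‖ ^ 2)) := by
        have hA := abs_nonneg A
        have : 0 ≤ |A| * (‖z.1‖ ^ 2 + ‖z.2‖ ^ 2 + ‖z.1‖ ^ 2 * ‖z.2‖ ^ 2) := by positivity
        have : 0 ≤ B * (1 + ‖z.1‖ ^ 2 * ‖z.2‖ ^ 2) := by positivity
        nlinarith
      _ = K * ((s * (1 + ‖z.1‖ ^ 2)) * (s * (1 + ‖z.2‖ ^ 2))) := by rw [hK]; field_simp
      _ ≤ _ := by gcongr <;> exact hquad _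
  have hexp : ∀ x : E3, Real.exp (s * ‖x‖ ^ 2) ^ N = Real.exp (s * N * ‖x‖ ^ 2) := fun x => by
    rw [← Real.exp_mul, mul_right_comm]
  have hint := ((integrable_exp_mul_gaussE hNs).mul_prod
    (integrable_exp_mul_gaussE hNs)).const_mul (K ^ N)
  refine hint.mono' (by have := measurable_gaussE; fun_prop)
    (Filter.Eventually.of_forall fun z => ?_)
  have h1 := gaussE_pos z.1
  have h2 := gaussE_pos z.2
  have h3 := hb0 z
  rw [Real.norm_of_nonneg (by positivity)]
  calc b z ^ N * (gaussE z.1 * gaussE z.2)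
      ≤ (K * (Real.exp (s * ‖z.1‖ ^ 2) * Real.exp (s * ‖z.2‖ ^ 2))) ^ N *
        (gaussE z.1 * gaussE z.2) := by gcongr; exact hbexp z
    _ = _ := by
      rw [Real.mul_rpow hK0.le (by positivity), Real.mul_rpow (by positivity) (by positivity),
        hexp, hexp]
      ring

lemma integrable_rpow_neg_mul_gaussE_of_le {b : E3 × E3 → ℝ} (hb : Measurable b)
    (hb0 : ∀ z, 0 ≤ b z) {C lam : ℝ} (hC : 0 < C) (hlam : 0 < lam)
    (hb_low : ∀ u v : E3, C * ‖u - v‖ ^ lam ≤ b (u, v)) :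
    Integrable (fun z : E3 × E3 => b z ^ (-lam⁻¹) * (gaussE z.1 * gaussE z.2)) := by
  refine (integrable_inv_norm_sub_mul_gaussE.const_mul (C ^ (-lam⁻¹))).mono'
    (by have := measurable_gaussE; fun_prop) ?_
  filter_upwards [ae_fst_ne_snd] with z hz
  have h1 := gaussE_pos z.1
  have h2 := gaussE_pos z.2
  have h3 := hb0 z
  have hr : 0 < ‖z.1 - z.2‖ := norm_pos_iff.2 (sub_ne_zero.2 hz)
  rw [Real.norm_of_nonneg (by positivity)]
  refine (mul_le_mul_of_nonneg_right ?_ (by positivity)).trans_eq (mul_assoc _ _ _)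
  calc b z ^ (-lam⁻¹) ≤ (C * ‖z.1 - z.2‖ ^ lam) ^ (-lam⁻¹) :=
        Real.rpow_le_rpow_of_nonpos (by positivity) (hb_low z.1 z.2) (by simpa using hlam.le)
    _ = _ := by
      rw [Real.mul_rpow hC.le (by positivity), ← Real.rpow_mul hr.le, mul_neg,
        mul_inv_cancel₀ hlam.ne', Real.rpow_neg_one]

/-- a kinetic collision kernel `b` with `C|u−v|^λ ≤ b(u,v) ≤ A + B|u−v|²`
is a proper interaction: `0 < ∬ b f⊗g < ∞`, the moments `∬ b^{1+ε} f⊗g` and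
`∬ b^{−ε} f⊗g` are finite for some `ε > 0`, and the normalized density
`b f⊗g / ∬ b f⊗g` is connected to `f ⊗ g` and to `M ⊗ M` by open exponential arcs. -/
theorem proper_interaction
    (b : EuclideanSpace ℝ (Fin 3) × EuclideanSpace ℝ (Fin 3) → ℝ)
    (hb_meas : Measurable b) (hb_nonneg : ∀ vw, 0 ≤ b vw)
    (A B C lam : ℝ) (hB : 0 < B) (hC : 0 < C) (hlam : 0 < lam)
    (hb_low : ∀ u v : EuclideanSpace ℝ (Fin 3), C * ‖u - v‖ ^ lam ≤ b (u, v))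
    (hb_up : ∀ u v : EuclideanSpace ℝ (Fin 3), b (u, v) ≤ A + B * ‖u - v‖ ^ 2)
    (f g : EuclideanSpace ℝ (Fin 3) → ℝ)
    (hf_meas : Measurable f)
    (hf_pos : ∀ᵐ x ∂(volume : Measure (EuclideanSpace ℝ (Fin 3))), 0 < f x)
    (hf_int : ∫⁻ x, ENNReal.ofReal (f x) ∂(volume : Measure (EuclideanSpace ℝ (Fin 3))) = 1)
    (hg_meas : Measurable g)
    (hg_pos : ∀ᵐ x ∂(volume : Measure (EuclideanSpace ℝ (Fin 3))), 0 < g x)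
    (hg_int : ∫⁻ x, ENNReal.ofReal (g x) ∂(volume : Measure (EuclideanSpace ℝ (Fin 3))) = 1)
    (hf_arc : ExpArcConnected (volume : Measure (EuclideanSpace ℝ (Fin 3))) gaussE f)
    (hg_arc : ExpArcConnected (volume : Measure (EuclideanSpace ℝ (Fin 3))) gaussE g) :
    (0 < ∫⁻ vw, ENNReal.ofReal (b vw * f vw.1 * g vw.2)
        ∂(volume : Measure (EuclideanSpace ℝ (Fin 3) × EuclideanSpace ℝ (Fin 3)))) ∧
    (∫⁻ vw, ENNReal.ofReal (b vw * f vw.1 * g vw.2)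
        ∂(volume : Measure (EuclideanSpace ℝ (Fin 3) × EuclideanSpace ℝ (Fin 3))) < ⊤) ∧
    (∃ ε > (0:ℝ),
      ∫⁻ vw, ENNReal.ofReal (b vw ^ (1 + ε) * f vw.1 * g vw.2)
          ∂(volume : Measure (EuclideanSpace ℝ (Fin 3) × EuclideanSpace ℝ (Fin 3))) < ⊤ ∧
      ∫⁻ vw, ENNReal.ofReal (b vw ^ (-ε) * f vw.1 * g vw.2)
          ∂(volume : Measure (EuclideanSpace ℝ (Fin 3) × EuclideanSpace ℝ (Fin 3))) < ⊤) ∧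
    ExpArcConnected (volume : Measure (EuclideanSpace ℝ (Fin 3) × EuclideanSpace ℝ (Fin 3)))
      (fun vw => b vw * f vw.1 * g vw.2 /
        (∫⁻ vw', ENNReal.ofReal (b vw' * f vw'.1 * g vw'.2)
          ∂(volume : Measure (EuclideanSpace ℝ (Fin 3) × EuclideanSpace ℝ (Fin 3)))).toReal)
      (fun vw => f vw.1 * g vw.2) ∧
    ExpArcConnected (volume : Measure (EuclideanSpace ℝ (Fin 3) × EuclideanSpace ℝ (Fin 3)))
      (fun vw => b vw * f vw.1 * g vw.2 /
        (∫⁻ vw', ENNReal.ofReal (b vw' * f vw'.1 * g vw'.2)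
          ∂(volume : Measure (EuclideanSpace ℝ (Fin 3) × EuclideanSpace ℝ (Fin 3)))).toReal)
      (fun vw => gaussE vw.1 * gaussE vw.2) := by
  have hM := measurable_gaussE
  have hM0 : ∀ᵐ x : E3, 0 < gaussE x := Filter.Eventually.of_forall gaussE_pos
  have hpos : ∀ᵐ z : E3 × E3, 0 < f z.1 ∧ 0 < g z.2 := by
    rw [Measure.volume_eq_prod]
    exact (Measure.quasiMeasurePreserving_fst.ae hf_pos).and
      (Measure.quasiMeasurePreserving_snd.ae hg_pos)
  have hb_pos : ∀ᵐ z : E3 × E3, 0 < b z := by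
    filter_upwards [ae_fst_ne_snd] with z hz
    have hr : 0 < ‖z.1 - z.2‖ := norm_pos_iff.2 (sub_ne_zero.2 hz)
    exact lt_of_lt_of_le (by positivity) (hb_low z.1 z.2)
  obtain ⟨δf, hδf, hf_arc⟩ := hf_arc.exists_integrable hM hf_meas hM0 hf_pos
  obtain ⟨δg, hδg, hg_arc⟩ := hg_arc.exists_integrable hM hg_meas hM0 hg_pos
  have hfg : ∀ t ∈ Set.Icc (-min δf δg) (1 + min δf δg), Integrable (fun z : E3 × E3 =>
      (gaussE z.1 * gaussE z.2) ^ (1 - t) * (f z.1 * g z.2) ^ t) := by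
    rintro t ⟨ht1, ht2⟩
    have h1 := min_le_left δf δg
    have h2 := min_le_right δf δg
    refine ((hf_arc t ⟨by linarith, by linarith⟩).mul_prod
      (hg_arc t ⟨by linarith, by linarith⟩)).congr ?_
    rw [← Measure.volume_eq_prod]
    filter_upwards [hpos] with z hz
    rw [Real.mul_rpow (gaussE_pos _).le (gaussE_pos _).le, Real.mul_rpow hz.1.le hz.2.le]
    ring
  have hδ : 0 < min δf δg := lt_min hδf hδg
  have hm_meas : Measurable fun z : E3 × E3 => gaussE z.1 * gaussE z.2 := by fun_prop
  have hF_meas : Measurable fun z : E3 × E3 => f z.1 * g z.2 := by fun_prop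
  have hF_pos : ∀ᵐ z : E3 × E3, 0 < f z.1 * g z.2 := hpos.mono fun z hz => mul_pos hz.1 hz.2
  have hm_pos : ∀ z : E3 × E3, 0 < gaussE z.1 * gaussE z.2 := fun z =>
    mul_pos (gaussE_pos _) (gaussE_pos _)
  have hF_upper := hfg (1 + min δf δg) ⟨by linarith, le_rfl⟩
  have hF_lower := hfg (-min δf δg) ⟨le_rfl, by linarith⟩
  have hb_neg := integrable_rpow_neg_mul_gaussE_of_le hb_meas hb_nonneg hC hlam hb_low
  obtain ⟨ε, hε, hmix⟩ := exists_integrable_rpow_mul_rpow_mul_rpow hb_meas hF_meas hm_meas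
    hb_nonneg hF_pos hm_pos (inv_pos.2 hlam) hδ integrable_gaussE_mul_gaussE
    (fun N hN => integrable_rpow_mul_gaussE_of_le hb_meas hb_nonneg hB hb_up hN)
    hb_neg hF_upper hF_lower
  have hmoment : ∀ s ∈ Set.Icc (-ε) (1 + ε),
      Integrable (fun z : E3 × E3 => b z ^ s * f z.1 * g z.2) := by
    intro s hs
    refine (hmix s hs 1 ⟨by linarith, by linarith⟩).congr (Filter.Eventually.of_forall fun z => ?_)
    simp [mul_assoc]
  have hbfg : Integrable (fun z : E3 × E3 => b z * f z.1 * g z.2) := by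
    simpa using hmoment 1 ⟨by linarith, by linarith⟩
  set Z := ∫⁻ z : E3 × E3, ENNReal.ofReal (b z * f z.1 * g z.2) with hZ
  have hZ_top : Z < ⊤ := hbfg.lintegral_lt_top
  have hZ_pos : 0 < Z := by
    refine pos_iff_ne_zero.2 fun h0 => ?_
    rw [hZ, lintegral_eq_zero_iff (by fun_prop)] at h0
    obtain ⟨z, hz0, hz, hbz⟩ := (h0.and (hpos.and hb_pos)).exists
    have := mul_pos (mul_pos hbz hz.1) hz.2
    simp only [Pi.zero_apply, ENNReal.ofReal_eq_zero] at hz0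
    linarith
  have hZr : 0 < Z.toReal := ENNReal.toReal_pos hZ_pos.ne' hZ_top.ne
  have hI : Set.Icc (0 : ℝ) 1 ⊆ Set.Ioo (-ε) (1 + ε) :=
    Set.Icc_subset_Ioo (by linarith) (by linarith)
  have hnormalized : ∀ r : ℝ, ∀ᵐ z : E3 × E3, (b z * f z.1 * g z.2 / Z.toReal) ^ r =
      (Z.toReal ^ r)⁻¹ * (b z ^ r * (f z.1 * g z.2) ^ r) := fun r => by
    filter_upwards [hpos] with z hz
    have := mul_pos hz.1 hz.2
    have hbz := hb_nonneg z
    rw [mul_assoc, Real.div_rpow (by positivity) hZr.le, Real.mul_rpow hbz this.le]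
    ring
  refine ⟨hZ_pos, hZ_top, ⟨ε, hε, ?_, ?_⟩, ⟨_, isOpen_Ioo, hI, fun t ht => ?_⟩,
    ⟨_, isOpen_Ioo, hI, fun t ht => ?_⟩⟩
  · exact (hmoment _ ⟨by linarith, le_rfl⟩).lintegral_lt_top
  · exact (hmoment _ ⟨le_rfl, by linarith⟩).lintegral_lt_top
  · have hs : 1 - t ∈ Set.Icc (-ε) (1 + ε) := ⟨by linarith [ht.2], by linarith [ht.1]⟩
    refine (((hmoment _ hs).const_mul (Z.toReal ^ (1 - t))⁻¹).congr ?_).lintegral_lt_top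
    filter_upwards [hpos, hnormalized (1 - t)] with z hz hnz
    have hfgz := mul_pos hz.1 hz.2
    rw [hnz, mul_assoc (b z ^ (1 - t)), mul_assoc _⁻¹, mul_assoc (b z ^ (1 - t)),
      ← Real.rpow_add hfgz, sub_add_cancel, Real.rpow_one]
  · have hs : 1 - t ∈ Set.Icc (-ε) (1 + ε) := ⟨by linarith [ht.2], by linarith [ht.1]⟩
    refine (((hmix _ hs _ hs).const_mul (Z.toReal ^ (1 - t))⁻¹).congr ?_).lintegral_lt_top
    filter_upwards [hnormalized (1 - t)] with z hnz
    rw [hnz, _root_.sub_sub_cancel]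
    ring
end

section
/- Let P = γ₃ ⊗ γ₃ on ℝ³ × ℝ³ and let g : ℝ³ × ℝ³ → ℝ be P-integrable. Let 𝔪 be the σ-algebra on ℝ³ × ℝ³ generated by the collision-invariants map T(v, w) = (v + w, |v|² + |w|²), i.e. the comap of the Borel σ-algebra of ℝ³ × ℝ under T. Then the function (v, w) ↦ ∫_{S²} g(Â_σ(v, w)) dμ_{S²}(σ) is a version of the conditional expectation E_P[g | 𝔪]; that is, P-almost everywhere, E_P[g | 𝔪](v, w) = ∫_{S²} g((v+w)/2 + (|v−w|/2)σ, (v+w)/2 − (|v−w|/2)σ) dμ_{S²}(σ). -/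
open MeasureTheory ENNReal

/-- The standard Gaussian (Maxwell) probability measure `γ₃` on `ℝ³`. -/
noncomputable def gauss3 : Measure (EuclideanSpace ℝ (Fin 3)) :=
  (volume : Measure (EuclideanSpace ℝ (Fin 3))).withDensity fun x =>
    ENNReal.ofReal ((2 * Real.pi) ^ (-(3 : ℝ) / 2) * Real.exp (-‖x‖ ^ 2 / 2))

/-- The uniform (normalized rotation-invariant) probability measure on the unit
sphere `S² ⊂ ℝ³`. -/
noncomputable def uniformSphere : Measure (Metric.sphere (0 : EuclideanSpace ℝ (Fin 3)) 1) :=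
  ((volume : Measure (EuclideanSpace ℝ (Fin 3))).toSphere Set.univ)⁻¹ •
    (volume : Measure (EuclideanSpace ℝ (Fin 3))).toSphere

/-- The collision transformation `Â_σ(v, w) = ((v+w)/2 + (|v−w|/2)σ, (v+w)/2 − (|v−w|/2)σ)`. -/
noncomputable def Ahat (σ : Metric.sphere (0 : EuclideanSpace ℝ (Fin 3)) 1)
    (vw : EuclideanSpace ℝ (Fin 3) × EuclideanSpace ℝ (Fin 3)) :
    EuclideanSpace ℝ (Fin 3) × EuclideanSpace ℝ (Fin 3) :=
  ((2:ℝ)⁻¹ • (vw.1 + vw.2) + (‖vw.1 - vw.2‖ / 2) • (σ : EuclideanSpace ℝ (Fin 3)),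
   (2:ℝ)⁻¹ • (vw.1 + vw.2) - (‖vw.1 - vw.2‖ / 2) • (σ : EuclideanSpace ℝ (Fin 3)))

/-- The collision-invariants map `T(v, w) = (v + w, |v|² + |w|²)`. -/
noncomputable def collInv (vw : EuclideanSpace ℝ (Fin 3) × EuclideanSpace ℝ (Fin 3)) :
    EuclideanSpace ℝ (Fin 3) × ℝ :=
  (vw.1 + vw.2, ‖vw.1‖ ^ 2 + ‖vw.2‖ ^ 2)

/-- Integration in polar coordinates with respect to an additive Haar measure. -/
lemma lintegral_addHaar_eq_lintegral_toSphere {E : Type*} [NormedAddCommGroup E]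
    [NormedSpace ℝ E] [FiniteDimensional ℝ E] [Nontrivial E] [MeasurableSpace E] [BorelSpace E]
    (μ : Measure E) [μ.IsAddHaarMeasure] {f : E → ℝ≥0∞} (hf : Measurable f) :
    ∫⁻ x, f x ∂μ = ∫⁻ s, ∫⁻ r, f ((r : ℝ) • (s : E))
      ∂(Measure.volumeIoiPow (Module.finrank ℝ E - 1)) ∂μ.toSphere := by
  have hmeas : Measurable fun p : Metric.sphere (0 : E) 1 × Set.Ioi (0 : ℝ) =>
      f ((p.2 : ℝ) • (p.1 : E)) := by fun_prop
  rw [← lintegral_prod _ hmeas.aemeasurable,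
    ← μ.measurePreserving_homeomorphUnitSphereProd.lintegral_comp hmeas]
  have hpt (x : ({0}ᶜ : Set E)) : f (((homeomorphUnitSphereProd E x).2 : ℝ) •
      ((homeomorphUnitSphereProd E x).1 : E)) = f x := by
    have hx : ‖(x : E)‖ ≠ 0 := norm_ne_zero_iff.2 x.2
    simp [smul_smul, hx]
  simp_rw [hpt]
  rw [lintegral_subtype_comap (measurableSet_singleton _).compl f,
    restrict_compl_singleton]

/-- Averaging over spheres centred at the origin preserves the integral against an additive Haar
measure. -/
lemma lintegral_lintegral_toSphere_norm_smul {E : Type*} [NormedAddCommGroup E]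
    [NormedSpace ℝ E] [FiniteDimensional ℝ E] [Nontrivial E] [MeasurableSpace E] [BorelSpace E]
    (μ : Measure E) [μ.IsAddHaarMeasure] {f : E → ℝ≥0∞} (hf : Measurable f) :
    ∫⁻ x, ∫⁻ s, f (‖x‖ • (s : E)) ∂μ.toSphere ∂μ = μ.toSphere Set.univ * ∫⁻ x, f x ∂μ := by
  have hmeas : Measurable fun x : E => ∫⁻ s, f (‖x‖ • (s : E)) ∂μ.toSphere :=
    Measurable.lintegral_prod_right' (f := fun p : E × Metric.sphere (0 : E) 1 =>
      f (‖p.1‖ • (p.2 : E))) (by fun_prop)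
  rw [lintegral_addHaar_eq_lintegral_toSphere μ hmeas,
    lintegral_addHaar_eq_lintegral_toSphere μ hf]
  have hnorm (s : Metric.sphere (0 : E) 1) (r : Set.Ioi (0 : ℝ)) :
      ‖(r : ℝ) • (s : E)‖ = r := by
    simp [norm_smul, abs_of_pos (Set.mem_Ioi.1 r.2)]
  simp_rw [hnorm]
  rw [lintegral_const, mul_comm, lintegral_lintegral_swap]
  exact Measurable.aemeasurable (by fun_prop)

instance isProbabilityMeasure_uniformSphere : IsProbabilityMeasure uniformSphere := by
  constructor
  rw [uniformSphere, Measure.smul_apply, smul_eq_mul]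
  exact ENNReal.inv_mul_cancel
    (Measure.measure_univ_ne_zero.2 (Measure.toSphere_ne_zero _)) (measure_ne_top _ _)

lemma lintegral_lintegral_uniformSphere_norm_smul {f : EuclideanSpace ℝ (Fin 3) → ℝ≥0∞}
    (hf : Measurable f) :
    ∫⁻ x : EuclideanSpace ℝ (Fin 3),
      ∫⁻ s, f (‖x‖ • (s : EuclideanSpace ℝ (Fin 3))) ∂uniformSphere = ∫⁻ x, f x := by
  have hne : (volume : Measure (EuclideanSpace ℝ (Fin 3))).toSphere Set.univ ≠ 0 :=
    Measure.measure_univ_ne_zero.2 (Measure.toSphere_ne_zero _)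
  simp_rw [uniformSphere, lintegral_smul_measure, smul_eq_mul]
  rw [lintegral_const_mul' _ _ (ENNReal.inv_ne_top.2 hne),
    lintegral_lintegral_toSphere_norm_smul _ hf, ← mul_assoc,
    ENNReal.inv_mul_cancel hne (measure_ne_top _ _), one_mul]

/-- The passage from velocities `(v, w)` to mean velocity and half relative velocity
`((v + w) / 2, (v - w) / 2)`. -/
noncomputable def centerOfMass :
    (EuclideanSpace ℝ (Fin 3) × EuclideanSpace ℝ (Fin 3)) ≃ₗ[ℝ]
      (EuclideanSpace ℝ (Fin 3) × EuclideanSpace ℝ (Fin 3)) where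
  toFun p := ((2 : ℝ)⁻¹ • (p.1 + p.2), (2 : ℝ)⁻¹ • (p.1 - p.2))
  invFun p := (p.1 + p.2, p.1 - p.2)
  map_add' p q := by ext <;> simp <;> ring
  map_smul' c p := by ext <;> simp <;> ring
  left_inv p := by ext <;> simp <;> ring
  right_inv p := by ext <;> simp <;> ring

lemma measurable_Ahat :
    Measurable fun q : (EuclideanSpace ℝ (Fin 3) × EuclideanSpace ℝ (Fin 3)) ×
      Metric.sphere (0 : EuclideanSpace ℝ (Fin 3)) 1 => Ahat q.2 q.1 := by
  unfold Ahat
  fun_prop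

lemma lintegral_lintegral_Ahat_volume
    {f : EuclideanSpace ℝ (Fin 3) × EuclideanSpace ℝ (Fin 3) → ℝ≥0∞} (hf : Measurable f) :
    ∫⁻ x, ∫⁻ s, f (Ahat s x) ∂uniformSphere = ∫⁻ x, f x := by
  have hL : Measurable centerOfMass :=
    (LinearMap.continuous_of_finiteDimensional centerOfMass.toLinearMap).measurable
  have : (volume : Measure (EuclideanSpace ℝ (Fin 3) ×
      EuclideanSpace ℝ (Fin 3))).IsAddHaarMeasure := by
    rw [Measure.volume_eq_prod]
    infer_instance
  obtain ⟨c, hc⟩ : ∃ c : ℝ≥0∞, Measure.map centerOfMass volume = c • volume :=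
    ⟨_, Measure.map_linearMap_addHaar_eq_smul_addHaar
      (f := centerOfMass.toLinearMap) volume centerOfMass.isUnit_det'.ne_zero⟩
  set k : EuclideanSpace ℝ (Fin 3) × EuclideanSpace ℝ (Fin 3) → ℝ≥0∞ :=
    fun p => f (p.1 + p.2, p.1 - p.2) with hk
  have hkm : Measurable k := by fun_prop
  have hchange {h : EuclideanSpace ℝ (Fin 3) × EuclideanSpace ℝ (Fin 3) → ℝ≥0∞}
      (hh : Measurable h) : ∫⁻ x, h (centerOfMass x) = c * ∫⁻ y, h y := by
    rw [← lintegral_map hh hL, hc, lintegral_smul_measure, smul_eq_mul]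
  have hright (x) : f x = k (centerOfMass x) := congrArg f (centerOfMass.symm_apply_apply x).symm
  have hleft (x) (s : Metric.sphere (0 : EuclideanSpace ℝ (Fin 3)) 1) : f (Ahat s x) =
      k ((centerOfMass x).1, ‖(centerOfMass x).2‖ • (s : EuclideanSpace ℝ (Fin 3))) := by
    simp [hk, Ahat, centerOfMass, norm_smul, div_eq_inv_mul]
  have hmeas : Measurable fun y : EuclideanSpace ℝ (Fin 3) × EuclideanSpace ℝ (Fin 3) =>
      ∫⁻ s, k (y.1, ‖y.2‖ • (s : EuclideanSpace ℝ (Fin 3))) ∂uniformSphere :=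
    Measurable.lintegral_prod_right'
      (f := fun p : (EuclideanSpace ℝ (Fin 3) × EuclideanSpace ℝ (Fin 3)) ×
        Metric.sphere (0 : EuclideanSpace ℝ (Fin 3)) 1 =>
          k (p.1.1, ‖p.1.2‖ • (p.2 : EuclideanSpace ℝ (Fin 3)))) (by fun_prop)
  simp_rw [hleft]
  rw [lintegral_congr hright, hchange hkm, hchange hmeas, Measure.volume_eq_prod,
    lintegral_prod _ hmeas.aemeasurable, lintegral_prod _ hkm.aemeasurable]
  congr 1
  refine lintegral_congr fun a => ?_
  exact lintegral_lintegral_uniformSphere_norm_smul (f := fun b => k (a, b)) (by fun_prop)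

lemma collInv_Ahat (s : Metric.sphere (0 : EuclideanSpace ℝ (Fin 3)) 1)
    (x : EuclideanSpace ℝ (Fin 3) × EuclideanSpace ℝ (Fin 3)) :
    collInv (Ahat s x) = collInv x := by
  have h1 := parallelogram_law_with_norm ℝ ((2 : ℝ)⁻¹ • (x.1 + x.2))
    ((‖x.1 - x.2‖ / 2) • (s : EuclideanSpace ℝ (Fin 3)))
  have h2 := parallelogram_law_with_norm ℝ x.1 x.2
  have h3 : ‖(s : EuclideanSpace ℝ (Fin 3))‖ = 1 := by simp
  refine Prod.ext ?_ ?_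
  · simp only [collInv, Ahat]
    module
  · simp only [collInv, Ahat]
    rw [h1, norm_smul, norm_smul, h3]
    simp only [norm_inv, Real.norm_ofNat, norm_div, norm_norm]
    linarith

instance isFiniteMeasure_gauss3 : IsFiniteMeasure gauss3 := by
  refine isFiniteMeasure_withDensity_ofReal
    (Integrable.hasFiniteIntegral (Integrable.const_mul ?_ _))
  have h := GaussianFourier.integral_rexp_neg_mul_sq_norm (V := EuclideanSpace ℝ (Fin 3))
    (b := 1 / 2) (by norm_num)
  have hpos : (0 : ℝ) <
      (Real.pi / (1 / 2)) ^ (Module.finrank ℝ (EuclideanSpace ℝ (Fin 3)) / 2 : ℝ) := by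
    positivity
  refine (not_imp_comm.1 integral_undef (h ▸ hpos.ne')).congr (.of_forall fun x => ?_)
  simp only
  congr 1
  ring

lemma gauss3_prod_gauss3 : gauss3.prod gauss3 =
    volume.withDensity fun x => ENNReal.ofReal ((2 * Real.pi) ^ (-(3 : ℝ) / 2) *
      (2 * Real.pi) ^ (-(3 : ℝ) / 2) * Real.exp (-(collInv x).2 / 2)) := by
  rw [gauss3, prod_withDensity (by fun_prop) (by fun_prop), ← Measure.volume_eq_prod]
  congr 1
  ext x
  rw [← ENNReal.ofReal_mul (by positivity), mul_mul_mul_comm, ← Real.exp_add]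
  congr 3
  simp only [collInv]
  ring

lemma measurable_collInv : Measurable collInv := by
  unfold collInv
  fun_prop

/-- A collision with uniformly distributed direction leaves the Maxwell distribution invariant. -/
lemma measurePreserving_Ahat :
    MeasurePreserving (fun q : (EuclideanSpace ℝ (Fin 3) × EuclideanSpace ℝ (Fin 3)) ×
        Metric.sphere (0 : EuclideanSpace ℝ (Fin 3)) 1 => Ahat q.2 q.1)
      ((gauss3.prod gauss3).prod uniformSphere) (gauss3.prod gauss3) := by
  have hA := measurable_Ahat
  refine ⟨hA, Measure.ext_of_lintegral _ fun f hf => ?_⟩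
  have hfA : Measurable fun q : (EuclideanSpace ℝ (Fin 3) × EuclideanSpace ℝ (Fin 3)) ×
      Metric.sphere (0 : EuclideanSpace ℝ (Fin 3)) 1 => f (Ahat q.2 q.1) := hf.comp hA
  have hT := measurable_collInv
  rw [lintegral_map hf hA, lintegral_prod _ hfA.aemeasurable, gauss3_prod_gauss3,
    lintegral_withDensity_eq_lintegral_mul _ (by fun_prop) hfA.lintegral_prod_right',
    lintegral_withDensity_eq_lintegral_mul _ (by fun_prop) hf]
  refine Eq.trans (lintegral_congr fun x => ?_) (lintegral_lintegral_Ahat_volume (by fun_prop))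
  simp only [Pi.mul_apply, collInv_Ahat]
  rw [lintegral_const_mul' _ _ ENNReal.ofReal_ne_top]

/-- The sphere average of a strongly measurable function is measurable with respect to the
collision invariants. -/
lemma stronglyMeasurable_comap_collInv_integral_Ahat
    {g : EuclideanSpace ℝ (Fin 3) × EuclideanSpace ℝ (Fin 3) → ℝ} (hg : StronglyMeasurable g) :
    StronglyMeasurable[MeasurableSpace.comap collInv inferInstance]
      fun x => ∫ s, g (Ahat s x) ∂uniformSphere := by
  let R : (EuclideanSpace ℝ (Fin 3) × ℝ) × Metric.sphere (0 : EuclideanSpace ℝ (Fin 3)) 1 →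
      EuclideanSpace ℝ (Fin 3) × EuclideanSpace ℝ (Fin 3) := fun q =>
    ((2 : ℝ)⁻¹ • q.1.1 + (√(2 * q.1.2 - ‖q.1.1‖ ^ 2) / 2) • (q.2 : EuclideanSpace ℝ (Fin 3)),
      (2 : ℝ)⁻¹ • q.1.1 - (√(2 * q.1.2 - ‖q.1.1‖ ^ 2) / 2) • (q.2 : EuclideanSpace ℝ (Fin 3)))
  have hR : Measurable R := by fun_prop
  have hAR (s) (x) : Ahat s x = R (collInv x, s) := by
    have h : 2 * (‖x.1‖ ^ 2 + ‖x.2‖ ^ 2) - ‖x.1 + x.2‖ ^ 2 = ‖x.1 - x.2‖ ^ 2 := by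
      linarith [parallelogram_law_with_norm ℝ x.1 x.2]
    simp only [R, Ahat, collInv, h, Real.sqrt_sq (norm_nonneg _)]
  simp_rw [hAR]
  exact (hg.comp_measurable hR).integral_prod_right'.comp_measurable
    (measurable_iff_comap_le.mpr le_rfl)

/-- for `P = γ₃ ⊗ γ₃` and integrable `g`, the function
`(v,w) ↦ ∫_{S²} g(Â_σ(v,w)) dμ_{S²}(σ)` is a version of the conditional expectation
of `g` given the σ-algebra generated by the collision invariants. -/
theorem sphere_average_is_condexp
    (g : EuclideanSpace ℝ (Fin 3) × EuclideanSpace ℝ (Fin 3) → ℝ)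
    (hg : Integrable g (gauss3.prod gauss3)) :
    (fun vw => ∫ σ, g (Ahat σ vw) ∂uniformSphere) =ᵐ[gauss3.prod gauss3]
      (gauss3.prod gauss3)[g | MeasurableSpace.comap collInv inferInstance] := by
  have hint := measurePreserving_Ahat.integrable_comp_of_integrable hg
  refine ae_eq_condExp_of_forall_setIntegral_eq measurable_collInv.comap_le hg
    (fun A _ _ => hint.integral_prod_left.integrableOn) ?_ ?_
  · rintro _ ⟨B, hB, rfl⟩ -
    have hA : MeasurableSet (collInv ⁻¹' B) := measurable_collInv hB
    have hind := hg.indicator hA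
    have hind_int := measurePreserving_Ahat.integrable_comp_of_integrable hind
    rw [← integral_indicator hA, ← integral_indicator hA]
    have hmap := integral_map measurePreserving_Ahat.aemeasurable
      (by rw [measurePreserving_Ahat.map_eq]; exact hind.aestronglyMeasurable)
    rw [measurePreserving_Ahat.map_eq] at hmap
    refine Eq.trans ?_ ((integral_prod _ hind_int).symm.trans hmap.symm)
    refine integral_congr_ae (.of_forall fun x => ?_)
    by_cases hx : collInv x ∈ B <;>
      simp [Set.indicator, collInv_Ahat, hx]
  · refine ⟨_, stronglyMeasurable_comap_collInv_integral_Ahat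
      hg.aestronglyMeasurable.stronglyMeasurable_mk, ?_⟩
    have hae := measurePreserving_Ahat.quasiMeasurePreserving.ae_eq_comp
      hg.aestronglyMeasurable.ae_eq_mk
    filter_upwards [Measure.ae_ae_of_ae_prod hae] with x hx
    exact integral_congr_ae hx
end

section
/- Let f : ℝ³ → (0, ∞) be a probability density, b : ℝ³ × ℝ³ → [0, ∞) measurable and invariant under all collision transformations (b(Â_σ(v, w)) = b(v, w) for all σ ∈ S² and all v, w), and g : ℝ³ → ℝ measurable. Write (v_σ, w_σ) = Â_σ(v, w) and assume the integrability condition ∬_{ℝ³×ℝ³} ∫_{S²} b(v,w) f(v) f(w) (|g(v_σ)| + |g(w_σ)| + |g(v)| + |g(w)|) dμ_{S²}(σ) dv dw < ∞. Then Maxwell's weak form of the Boltzmann operator holds: ∬ b(v,w) f(v) f(w) · Ag(v,w) dv dw = ∫_{ℝ³} Q(f)(v) g(v) dv, where Ag(v,w) = ∫_{S²} ½(g(v_σ) + g(w_σ)) dμ_{S²}(σ) − ½(g(v) + g(w)) and Q(f)(v) = ∫_{ℝ³} ∫_{S²} ( f(v_σ) f(w_σ) − f(v) f(w) ) b(v,w)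 dμ_{S²}(σ) dw. -/
open MeasureTheory ENNReal

/-- The operator `A`: `Ag(v,w) = ∫_{S²} ½(g(v_σ)+g(w_σ)) dμ(σ) − ½(g(v)+g(w))`. -/
noncomputable def Aop (g : EuclideanSpace ℝ (Fin 3) → ℝ)
    (vw : EuclideanSpace ℝ (Fin 3) × EuclideanSpace ℝ (Fin 3)) : ℝ :=
  (∫ σ, (g (Ahat σ vw).1 + g (Ahat σ vw).2) / 2 ∂uniformSphere) - (g vw.1 + g vw.2) / 2

/-- The spatially homogeneous Boltzmann collision operator with collision kernel `b`:
`Q(f)(v) = ∫_{ℝ³} ∫_{S²} (f(v_σ) f(w_σ) − f(v) f(w)) b(v,w) dμ(σ) dw`. -/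
noncomputable def Qop (b : EuclideanSpace ℝ (Fin 3) × EuclideanSpace ℝ (Fin 3) → ℝ)
    (f : EuclideanSpace ℝ (Fin 3) → ℝ) (v : EuclideanSpace ℝ (Fin 3)) : ℝ :=
  ∫ w, (∫ σ, (f (Ahat σ (v, w)).1 * f (Ahat σ (v, w)).2 - f v * f w) * b (v, w)
      ∂uniformSphere) ∂(volume : Measure (EuclideanSpace ℝ (Fin 3)))


local notation "E₃" => EuclideanSpace ℝ (Fin 3)
local notation "S₂" => Metric.sphere (0 : EuclideanSpace ℝ (Fin 3)) 1

theorem toSphere_univ_ne_zero :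
    (volume : Measure E₃).toSphere Set.univ ≠ 0 :=
  Measure.measure_univ_ne_zero.mpr (Measure.toSphere_ne_zero _)

instance : IsProbabilityMeasure uniformSphere where
  measure_univ := by
    rw [uniformSphere, Measure.smul_apply, smul_eq_mul]
    exact ENNReal.inv_mul_cancel toSphere_univ_ne_zero (measure_ne_top _ _)

/-- The radial part of Lebesgue measure on `ℝ³`, scaled to pair with `uniformSphere`. -/
noncomputable def radialMeasure : Measure (Set.Ioi (0 : ℝ)) :=
  (volume : Measure E₃).toSphere Set.univ • Measure.volumeIoiPow 2

instance : SFinite radialMeasure := by unfold radialMeasure; infer_instance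

theorem uniformSphere_prod_radialMeasure :
    uniformSphere.prod radialMeasure =
      (volume : Measure E₃).toSphere.prod (Measure.volumeIoiPow 2) := by
  rw [uniformSphere, radialMeasure, Measure.prod_smul_left, Measure.prod_smul_right, smul_smul,
    ENNReal.inv_mul_cancel toSphere_univ_ne_zero (measure_ne_top _ _), one_smul]

theorem measurePreserving_polar :
    MeasurePreserving (fun p : S₂ × Set.Ioi (0 : ℝ) => (p.2 : ℝ) • (p.1 : E₃))
      (uniformSphere.prod radialMeasure) volume := by
  have h := (volume : Measure E₃).measurePreserving_homeomorphUnitSphereProd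
  have h' := MeasurePreserving.symm (homeomorphUnitSphereProd E₃).toMeasurableEquiv h
  have hc := measurePreserving_subtype_coe (μa := (volume : Measure E₃))
    (measurableSet_singleton (0 : E₃)).compl
  rw [restrict_compl_singleton] at hc
  have := hc.comp h'
  rw [finrank_euclideanSpace_fin] at this
  rw [uniformSphere_prod_radialMeasure]
  exact this

/-- The direction of a vector, with an arbitrary value at `0`. -/
noncomputable def direction (u : E₃) : S₂ :=
  ⟨if u = 0 then EuclideanSpace.single 0 1 else ‖u‖⁻¹ • u, by
    split_ifs with h
    · simp
    · simp [norm_smul, h]⟩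

theorem norm_smul_direction (u : E₃) : ‖u‖ • (direction u : E₃) = u := by
  by_cases h : u = 0
  · simp [h]
  · simp [direction, h, smul_smul]

theorem direction_smul (σ : S₂) {r : ℝ} (hr : 0 < r) : direction (r • (σ : E₃)) = σ := by
  have h : ‖r • (σ : E₃)‖ = r := by simp [norm_smul, abs_of_pos hr]
  have := norm_smul_direction (r • (σ : E₃))
  rw [h] at this
  exact Subtype.ext (smul_right_injective _ hr.ne' this)

theorem measurable_direction : Measurable direction := by
  refine Measurable.subtype_mk ?_
  exact Measurable.ite (measurableSet_singleton 0) measurable_const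
    (measurable_norm.inv.smul measurable_id)

theorem measurePreserving_exchange_right {α β : Type*} [MeasurableSpace α] [MeasurableSpace β]
    (μ : Measure α) (ν : Measure β) [SFinite μ] [SFinite ν] :
    MeasurePreserving (fun p : (α × β) × α => ((p.2, p.1.2), p.1.1))
      ((μ.prod ν).prod μ) ((μ.prod ν).prod μ) :=
  ((Measure.measurePreserving_swap (μ := ν) (ν := μ)).prod (MeasurePreserving.id μ)).comp
    (Measure.measurePreserving_swap.comp (measurePreserving_prodAssoc μ ν μ))

theorem measurePreserving_exchange_direction :
    MeasurePreserving (fun p : E₃ × S₂ => (‖p.1‖ • (p.2 : E₃), direction p.1))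
      (volume.prod uniformSphere) (volume.prod uniformSphere) := by
  refine (measurePreserving_polar.prod (MeasurePreserving.id uniformSphere)).of_semiconj
    (measurePreserving_exchange_right uniformSphere radialMeasure) ?_ ?_
  · rintro ⟨⟨ω, r, hr⟩, σ⟩
    have hr' : 0 < r := hr
    simp [direction_smul ω hr', norm_smul, abs_of_pos hr']
  · exact (measurable_fst.norm.smul (measurable_subtype_coe.comp measurable_snd)).prodMk
      (measurable_direction.comp measurable_fst)

theorem measurePreserving_centerOfMass :
    MeasurePreserving (fun p : E₃ × E₃ => (p.1 + (2 : ℝ)⁻¹ • p.2, p.1 - (2 : ℝ)⁻¹ • p.2))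
      (volume.prod volume) (volume.prod volume) := by
  have h₁ : MeasurePreserving (fun p : E₃ × E₃ => (p.1, p.2 + (2 : ℝ)⁻¹ • p.1))
      (volume.prod volume) (volume.prod volume) :=
    (MeasurePreserving.id _).skew_product (g := fun x y => y + (2 : ℝ)⁻¹ • x) (by fun_prop)
      (.of_forall fun x => map_add_right_eq_self _ _)
  have h₂ : MeasurePreserving (fun p : E₃ × E₃ => (p.1, p.1 - p.2))
      (volume.prod volume) (volume.prod volume) :=
    (MeasurePreserving.id _).skew_product (g := fun x y => x - y) (by fun_prop)
      (.of_forall fun x => Measure.map_sub_left_eq_self _ _)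
  convert h₂.comp (Measure.measurePreserving_swap.comp
    (h₁.comp Measure.measurePreserving_swap)) using 1
  funext p
  ext1
  · rfl
  · simp only [Function.comp_apply, Prod.fst_swap, Prod.snd_swap]
    module

@[fun_prop]
theorem measurable_Ahat_s18 :
    Measurable (fun p : (E₃ × E₃) × S₂ => Ahat p.2 p.1) := by
  unfold Ahat
  fun_prop

/-- The collision map, which records the incoming direction as the new angular parameter. -/
noncomputable def collision (p : (E₃ × E₃) × S₂) : (E₃ × E₃) × S₂ :=
  (Ahat p.2 p.1, direction (p.1.1 - p.1.2))

theorem measurePreserving_collision :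
    MeasurePreserving collision
      ((volume.prod volume).prod uniformSphere) ((volume.prod volume).prod uniformSphere) := by
  refine ((measurePreserving_centerOfMass.prod (MeasurePreserving.id uniformSphere)).comp
    ((measurePreserving_prodAssoc volume volume uniformSphere).symm
      MeasurableEquiv.prodAssoc)).of_semiconj
    ((MeasurePreserving.id volume).prod measurePreserving_exchange_direction) ?_ ?_
  · rintro ⟨z, u, σ⟩
    have hu : (z + (2 : ℝ)⁻¹ • u) - (z - (2 : ℝ)⁻¹ • u) = u := by module
    have hz : (2 : ℝ)⁻¹ • ((z + (2 : ℝ)⁻¹ • u) + (z - (2 : ℝ)⁻¹ • u)) = z := by module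
    simp only [collision, Ahat, MeasurableEquiv.prodAssoc, Function.comp_apply, Prod.map_apply,
      MeasurableEquiv.symm_mk, MeasurableEquiv.coe_mk, Equiv.prodAssoc_symm_apply, id_eq, hu, hz,
      smul_smul, div_eq_inv_mul]
  · exact measurable_Ahat_s18.prodMk (measurable_direction.comp (by fun_prop))

theorem Ahat_sub (σ : S₂) (p : E₃ × E₃) :
    (Ahat σ p).1 - (Ahat σ p).2 = ‖p.1 - p.2‖ • (σ : E₃) := by
  simp only [Ahat]
  module

theorem Ahat_add (σ : S₂) (p : E₃ × E₃) : (Ahat σ p).1 + (Ahat σ p).2 = p.1 + p.2 := by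
  simp only [Ahat]
  module

theorem Ahat_direction_Ahat (σ : S₂) (p : E₃ × E₃) :
    Ahat (direction (p.1 - p.2)) (Ahat σ p) = p := by
  have h := norm_smul_direction (p.1 - p.2)
  have hn : ‖(Ahat σ p).1 - (Ahat σ p).2‖ = ‖p.1 - p.2‖ := by
    rw [Ahat_sub]
    simp [norm_smul]
  rw [Ahat, hn, Ahat_add, div_eq_inv_mul, mul_smul, h]
  ext1 <;> module

theorem Ahat_swap (σ : S₂) (p : E₃ × E₃) : Ahat σ p.swap = Ahat σ p := by
  simp [Ahat, norm_sub_rev, add_comm]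

theorem Ahat_neg_direction (p : E₃ × E₃) : Ahat (-direction (p.1 - p.2)) p = p.swap := by
  have h := norm_smul_direction (p.1 - p.2)
  rw [Ahat, div_eq_inv_mul, mul_smul, coe_neg_sphere, smul_neg, h]
  ext1
  · simp only [Prod.fst_swap]
    module
  · simp only [Prod.snd_swap]
    module

theorem symm_of_Ahat_invariant {b : E₃ × E₃ → ℝ} (hb : ∀ σ p, b (Ahat σ p) = b p)
    (p : E₃ × E₃) : b p.swap = b p := by
  rw [← Ahat_neg_direction, hb]

theorem measurePreserving_swap_velocities :
    MeasurePreserving (fun p : (E₃ × E₃) × S₂ => (p.1.swap, p.2))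
      ((volume.prod volume).prod uniformSphere) ((volume.prod volume).prod uniformSphere) :=
  Measure.measurePreserving_swap.prod (MeasurePreserving.id uniformSphere)

/-- Maxwell's weak form of the Boltzmann operator:
`∬ b(v,w) f(v) f(w) Ag(v,w) dv dw = ∫ Q(f)(v) g(v) dv`. -/
theorem maxwell_weak_form
    (f : EuclideanSpace ℝ (Fin 3) → ℝ) (hf_pos : ∀ v, 0 < f v) (hf_meas : Measurable f)
    (hf_int : ∫⁻ v, ENNReal.ofReal (f v) ∂(volume : Measure (EuclideanSpace ℝ (Fin 3))) = 1)
    (b : EuclideanSpace ℝ (Fin 3) × EuclideanSpace ℝ (Fin 3) → ℝ)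
    (hb_meas : Measurable b) (hb_nonneg : ∀ vw, 0 ≤ b vw)
    (hb_inv : ∀ (σ : Metric.sphere (0 : EuclideanSpace ℝ (Fin 3)) 1)
      (vw : EuclideanSpace ℝ (Fin 3) × EuclideanSpace ℝ (Fin 3)), b (Ahat σ vw) = b vw)
    (g : EuclideanSpace ℝ (Fin 3) → ℝ) (hg_meas : Measurable g)
    (h_int : ∫⁻ vw : EuclideanSpace ℝ (Fin 3) × EuclideanSpace ℝ (Fin 3),
        (∫⁻ σ, ENNReal.ofReal (b vw * f vw.1 * f vw.2 *
          (|g (Ahat σ vw).1| + |g (Ahat σ vw).2| + |g vw.1| + |g vw.2|)) ∂uniformSphere)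
        ∂(volume : Measure (EuclideanSpace ℝ (Fin 3) × EuclideanSpace ℝ (Fin 3))) < ⊤) :
    ∫ vw : EuclideanSpace ℝ (Fin 3) × EuclideanSpace ℝ (Fin 3),
        b vw * f vw.1 * f vw.2 * Aop g vw
        ∂(volume : Measure (EuclideanSpace ℝ (Fin 3) × EuclideanSpace ℝ (Fin 3))) =
      ∫ v, Qop b f v * g v ∂(volume : Measure (EuclideanSpace ℝ (Fin 3))) := by
  set m : Measure ((E₃ × E₃) × S₂) := (volume.prod volume).prod uniformSphere with hm
  let F (p : (E₃ × E₃) × S₂) : ℝ := b p.1 * f p.1.1 * f p.1.2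
  have hF_nonneg (p) : 0 ≤ F p :=
    mul_nonneg (mul_nonneg (hb_nonneg _) (hf_pos _).le) (hf_pos _).le
  have hF_meas : Measurable F := by fun_prop
  have h_total : Integrable (fun p => F p * (|g (Ahat p.2 p.1).1| + |g (Ahat p.2 p.1).2| +
      |g p.1.1| + |g p.1.2|)) m := by
    have h_meas : Measurable (fun p => F p * (|g (Ahat p.2 p.1).1| + |g (Ahat p.2 p.1).2| +
      |g p.1.1| + |g p.1.2|)) := by fun_prop
    refine ⟨h_meas.aestronglyMeasurable, ?_⟩
    rw [hasFiniteIntegral_iff_ofReal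
      (.of_forall fun p => mul_nonneg (hF_nonneg p) (by positivity)), hm,
      lintegral_prod _ h_meas.ennreal_ofReal.aemeasurable]
    exact h_int
  have h_dom {φ : (E₃ × E₃) × S₂ → ℝ} (hφ : Measurable φ)
      (h : ∀ p, |φ p| ≤ |g (Ahat p.2 p.1).1| + |g (Ahat p.2 p.1).2| + |g p.1.1| + |g p.1.2|) :
      Integrable (fun p => F p * φ p) m := by
    refine h_total.mono' (hF_meas.mul hφ).aestronglyMeasurable (.of_forall fun p => ?_)
    rw [Real.norm_eq_abs, abs_mul, abs_of_nonneg (hF_nonneg p)]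
    exact mul_le_mul_of_nonneg_left (h p) (hF_nonneg p)
  have h_bound (x y z w : ℝ) : |x| ≤ |x| + |y| + |z| + |w| ∧ |y| ≤ |x| + |y| + |z| + |w| ∧
      |z| ≤ |x| + |y| + |z| + |w| ∧ |w| ≤ |x| + |y| + |z| + |w| := by
    have := abs_nonneg x
    have := abs_nonneg y
    have := abs_nonneg z
    have := abs_nonneg w
    refine ⟨?_, ?_, ?_, ?_⟩ <;> linarith
  have hv' : Integrable (fun p => F p * g (Ahat p.2 p.1).1) m :=
    h_dom (by fun_prop) fun p => (h_bound _ _ _ _).1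
  have hw' : Integrable (fun p => F p * g (Ahat p.2 p.1).2) m :=
    h_dom (by fun_prop) fun p => (h_bound _ _ _ _).2.1
  have hv : Integrable (fun p => F p * g p.1.1) m :=
    h_dom (by fun_prop) fun p => (h_bound _ _ _ _).2.2.1
  have hw : Integrable (fun p => F p * g p.1.2) m :=
    h_dom (by fun_prop) fun p => (h_bound _ _ _ _).2.2.2
  let K (p : (E₃ × E₃) × S₂) : ℝ :=
    b p.1 * f (Ahat p.2 p.1).1 * f (Ahat p.2 p.1).2 * g p.1.1
  let L (p : (E₃ × E₃) × S₂) : ℝ :=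
    b p.1 * f (Ahat p.2 p.1).1 * f (Ahat p.2 p.1).2 * g p.1.2
  have hK_meas : Measurable K := by fun_prop
  have hL_meas : Measurable L := by fun_prop
  have hK_comp (p) : K (collision p) = F p * g (Ahat p.2 p.1).1 := by
    simp only [K, F, collision, Ahat_direction_Ahat, hb_inv]
  have hL_comp (p) : L (collision p) = F p * g (Ahat p.2 p.1).2 := by
    simp only [L, F, collision, Ahat_direction_Ahat, hb_inv]
  have h_integral_comp {T : (E₃ × E₃) × S₂ → (E₃ × E₃) × S₂} (hT : MeasurePreserving T m m)
      {φ : (E₃ × E₃) × S₂ → ℝ} (hφ : Measurable φ) : ∫ p, φ (T p) ∂m = ∫ p, φ p ∂m := by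
    conv_rhs => rw [← hT.map_eq]
    exact (integral_map hT.aemeasurable hφ.aestronglyMeasurable).symm
  have hK_int : Integrable K m := by
    rw [← measurePreserving_collision.integrable_comp hK_meas.aestronglyMeasurable]
    exact hv'.congr (.of_forall fun p => (hK_comp p).symm)
  have hv'_eq : ∫ p, F p * g (Ahat p.2 p.1).1 ∂m = ∫ p, K p ∂m := by
    simp_rw [← hK_comp]
    exact h_integral_comp measurePreserving_collision hK_meas
  have hw'_eq : ∫ p, F p * g (Ahat p.2 p.1).2 ∂m = ∫ p, K p ∂m := by
    simp_rw [← hL_comp]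
    rw [h_integral_comp measurePreserving_collision hL_meas,
      ← h_integral_comp measurePreserving_swap_velocities hK_meas]
    refine integral_congr_ae (.of_forall fun p => ?_)
    simp only [K, L, Ahat_swap, symm_of_Ahat_invariant hb_inv, Prod.fst_swap]
  have hw_eq : ∫ p, F p * g p.1.2 ∂m = ∫ p, F p * g p.1.1 ∂m := by
    rw [← h_integral_comp measurePreserving_swap_velocities (φ := fun p => F p * g p.1.1)
      (by fun_prop)]
    refine integral_congr_ae (.of_forall fun p => ?_)
    simp only [F, symm_of_Ahat_invariant hb_inv, Prod.fst_swap, Prod.snd_swap]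
    ring
  have h_out : Integrable
      (fun p => (F p * g (Ahat p.2 p.1).1 + F p * g (Ahat p.2 p.1).2) / 2) m :=
    (hv'.add hw').div_const 2
  have h_in : Integrable (fun p => (F p * g p.1.1 + F p * g p.1.2) / 2) m :=
    (hv.add hw).div_const 2
  have hKv : Integrable (fun p => K p - F p * g p.1.1) m := hK_int.sub hv
  have h_diff : Integrable (fun p => (F p * g (Ahat p.2 p.1).1 + F p * g (Ahat p.2 p.1).2) / 2 -
      (F p * g p.1.1 + F p * g p.1.2) / 2) m := h_out.sub h_in
  have h_left : ∫ vw : E₃ × E₃, b vw * f vw.1 * f vw.2 * Aop g vw =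
      ∫ p, ((F p * g (Ahat p.2 p.1).1 + F p * g (Ahat p.2 p.1).2) / 2 -
        (F p * g p.1.1 + F p * g p.1.2) / 2) ∂m := by
    rw [hm, integral_prod _ h_diff]
    refine integral_congr_ae ?_
    filter_upwards [h_out.prod_right_ae] with p hp
    have hp' : Integrable (fun σ => (F (p, σ) * g (Ahat σ p).1 + F (p, σ) * g (Ahat σ p).2) / 2)
      uniformSphere := hp
    refine Eq.trans ?_ (integral_sub hp' (integrable_const
      ((b p * f p.1 * f p.2 * g p.1 + b p * f p.1 * f p.2 * g p.2) / 2))).symm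
    rw [integral_const, probReal_univ, one_smul, Aop, mul_sub, ← integral_const_mul]
    simp only [F, ← mul_add, mul_div_assoc]
  have h_right : ∫ v, Qop b f v * g v = ∫ p, (K p - F p * g p.1.1) ∂m := by
    rw [hm, integral_prod _ hKv, integral_prod _ hKv.integral_prod_left]
    refine integral_congr_ae (.of_forall fun v => ?_)
    simp only [Qop, ← integral_mul_const]
    refine integral_congr_ae (.of_forall fun w => integral_congr_ae (.of_forall fun σ => ?_))
    simp only [K, F]
    ring
  rw [h_left, h_right, integral_sub h_out h_in,
    integral_div, integral_div, integral_add hv' hw', integral_add hv hw, integral_sub hK_int hv,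
    hv'_eq, hw'_eq, hw_eq]
  ring
end
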